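/- arXiv:1407.2983 — 3 statements merged into one kernel-verified Lean document; each statement's English description precedes it below -/
import Mathlib

section
/- Define Υ(s) = (s − 1/2) ∫₀^∞ λ(t) / ((t² + 1/4)(t² + (s − 1/2)²)) dt for Re(s) > 1, where λ(t) = ξ(1/2 + it). Then Υ(s) = (π/2)(1/(s−1) − 2ξ(s)/(s(s−1)) + π^(-s/2) ∑_{n≥1} n^(-s) Γ(s/2, π n²)). -/
open MeasureTheory Real Complex

/-- Lower incomplete gamma function `γ(s, x)`. -/
noncomputable def lowerGamma (s : ℂ) (x : ℝ) : ℂ :=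
  ∫ t in (0 : ℝ)..x, (t : ℂ) ^ (s - 1) * Complex.exp (-t)

/-- Upper incomplete gamma function `Γ(s, x)`. -/
noncomputable def upperGamma (s : ℂ) (x : ℝ) : ℂ :=
  ∫ t in Set.Ioi x, (t : ℂ) ^ (s - 1) * Complex.exp (-t)

/-- Modified Jacobi theta function `ψ(x) = ∑_{n≥1} e^(-π n² x)`. -/
noncomputable def jpsi (x : ℝ) : ℝ := ∑' n : ℕ+, Real.exp (-π * n ^ 2 * x)

/-- The Riemann xi function `ξ(s) = (1/2) s (s-1) π^(-s/2) Γ(s/2) ζ(s)`. -/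
noncomputable def xi (s : ℂ) : ℂ :=
  s * (s - 1) / 2 * ((π : ℂ) ^ (-s / 2) * Complex.Gamma (s / 2) * riemannZeta s)


noncomputable def phi9 (x : ℝ) : ℂ := (HurwitzZeta.evenKernel 0 x : ℂ) - 1
noncomputable def M9 (z : ℂ) : ℂ := ∫ x in Set.Ioi (1:ℝ), (x:ℂ) ^ (z - 1) * phi9 x
noncomputable def A9 : ℝ → ℂ := (Set.Ioi (1:ℝ)).indicator phi9

open HurwitzZeta in
lemma modif_conv9 (z : ℂ) : MellinConvergent (hurwitzEvenFEPair 0).f_modif z := by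
  set P := hurwitzEvenFEPair 0
  have hP := P.isStrongFEPair_toStrongFEPair
  obtain ⟨b, hb⟩ := exists_gt z.re
  obtain ⟨c, hc⟩ := exists_lt z.re
  refine mellinConvergent_of_isBigO_rpow (a := b) (b := c) P.hf_modif_int ?_ hb ?_ hc
  · exact hP.hf_top _
  · exact hP.hf_zero _

open HurwitzZeta in
lemma modif_eq9 {x : ℝ} (hx : 1 < x) : (hurwitzEvenFEPair 0).f_modif x = phi9 x := by
  have h0 : ¬ (x < 1) := by linarith
  simp [WeakFEPair.f_modif, phi9, hurwitzEvenFEPair, Set.indicator, hx, h0]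

open HurwitzZeta in
lemma phi_int9 (z : ℂ) : IntegrableOn (fun x : ℝ ↦ (x:ℂ) ^ (z - 1) * phi9 x) (Set.Ioi 1) := by
  have := (modif_conv9 z).mono_set (Set.Ioi_subset_Ioi zero_le_one)
  refine this.congr_fun (fun x hx ↦ ?_) measurableSet_Ioi
  simp [modif_eq9 hx]

lemma A_smul9 (z : ℂ) : (fun x : ℝ ↦ (x:ℂ) ^ (z - 1) • A9 x) =
    (Set.Ioi (1:ℝ)).indicator (fun x : ℝ ↦ (x:ℂ) ^ (z - 1) * phi9 x) := by
  ext x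
  by_cases h : x ∈ Set.Ioi (1:ℝ) <;> simp [A9, Set.indicator, h]

lemma A_conv9 (z : ℂ) : MellinConvergent A9 z := by
  unfold MellinConvergent
  rw [A_smul9]
  exact ((phi_int9 z).integrable_indicator measurableSet_Ioi).integrableOn

lemma A_mellin9 (z : ℂ) : mellin A9 z = M9 z := by
  unfold mellin
  rw [A_smul9, setIntegral_indicator measurableSet_Ioi, Set.Ioi_inter_Ioi]
  simp [M9]

open HurwitzZeta in
lemma modif_split9 {x : ℝ} (hx : 0 < x) (h1 : x ≠ 1) : (hurwitzEvenFEPair 0).f_modif x =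
    A9 x + (x:ℂ) ^ (-(1/2):ℂ) • A9 x⁻¹ := by
  rcases lt_or_gt_of_ne h1 with h | h
  · have h2 : 1 < x⁻¹ := (one_lt_inv₀ hx).2 h
    have h3 := (hurwitzEvenFEPair 0).hf_modif_FE x⁻¹ (by positivity)
    rw [show (hurwitzEvenFEPair 0).g_modif = (hurwitzEvenFEPair 0).symm.f_modif from rfl,
      hurwitzEvenFEPair_zero_symm, modif_eq9 h2] at h3
    have h4 : ¬ (1 < x) := by linarith
    simp only [one_div, inv_inv] at h3
    rw [h3]
    have : ((x⁻¹ ^ (2⁻¹:ℝ) : ℝ) : ℂ) = (x:ℂ) ^ (-2⁻¹:ℂ) := by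
      rw [Real.inv_rpow hx.le, ← Real.rpow_neg hx.le, Complex.ofReal_cpow hx.le]; simp
    simp [A9, Set.indicator, h2, h4, hurwitzEvenFEPair, this]
  · have h2 : ¬ (1 < x⁻¹) := by have := inv_lt_one_of_one_lt₀ h; linarith
    rw [modif_eq9 h]
    simp [A9, Set.indicator, h2, h]

open HurwitzZeta in
lemma Lambda0_eq9 (s : ℂ) : completedRiemannZeta₀ s = (M9 (s/2) + M9 ((1-s)/2)) / 2 := by
  have h1 : completedRiemannZeta₀ s = mellin (hurwitzEvenFEPair 0).f_modif (s/2) / 2 := rfl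
  have h2 : mellin (hurwitzEvenFEPair 0).f_modif (s/2) =
      mellin (fun x : ℝ ↦ A9 x + (x:ℂ) ^ (-(1/2):ℂ) • A9 x⁻¹) (s/2) := by
    unfold mellin
    refine setIntegral_congr_ae measurableSet_Ioi ?_
    have : ∀ᵐ x : ℝ, x ≠ 1 := by simp [ae_iff]
    filter_upwards [this] with x hx h
    rw [modif_split9 h hx]
  have hc : MellinConvergent (fun x : ℝ ↦ (x:ℂ) ^ (-(1/2):ℂ) • A9 x⁻¹) (s/2) := by
    rw [MellinConvergent.cpow_smul]
    have := (MellinConvergent.comp_rpow (f := A9) (s := s/2 + -(1/2)) (a := -1) (by norm_num)).2 (A_conv9 _)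
    simpa [Real.rpow_neg_one] using this
  have h3 := (hasMellin_add (A_conv9 (s/2)) hc).2
  rw [h1, h2, h3, mellin_cpow_smul, mellin_comp_inv, A_mellin9, A_mellin9]
  congr 3
  ring_nf

lemma denom_ne9 {a : ℂ} (ha : 0 < a.re) (t : ℝ) : (t:ℂ)^2 + a^2 ≠ 0 := by
  have : (t:ℂ)^2 + a^2 = (a + t * I) * (a - t * I) := by
    ring_nf; simp
  rw [this]
  refine mul_ne_zero ?_ ?_ <;>
  · intro h
    have := congrArg Complex.re h
    simp at this
    linarith

lemma expabs_int9 {a : ℂ} (ha : 0 < a.re) : Integrable (fun y : ℝ ↦ cexp (-a * |y|)) := by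
  rw [← integrableOn_univ, ← Set.Iic_union_Ioi (a := (0:ℝ))]
  refine IntegrableOn.union ?_ ?_
  · refine (integrableOn_exp_mul_complex_Iic (a := a) ha 0).congr_fun (fun y hy ↦ ?_) measurableSet_Iic
    simp [abs_of_nonpos (Set.mem_Iic.1 hy)]
  · refine (integrableOn_exp_mul_complex_Ioi (a := -a) (by simpa) 0).congr_fun (fun y hy ↦ ?_) measurableSet_Ioi
    simp [abs_of_pos (Set.mem_Ioi.1 hy)]

lemma expabs_ft9 {a : ℂ} (ha : 0 < a.re) (t : ℝ) :
    ∫ y : ℝ, cexp (-(t * I) * y) * cexp (-a * |y|) = 2 * a / ((t:ℂ)^2 + a^2) := by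
  have hi : Integrable (fun y : ℝ ↦ cexp (-(t * I) * y) * cexp (-a * |y|)) := by
    refine (expabs_int9 ha).bdd_mul (c := 1) (by fun_prop) (.of_forall fun y ↦ ?_)
    rw [show (-(t * I) * y : ℂ) = ((-(t*y) : ℝ) : ℂ) * I by push_cast; ring, Complex.norm_exp_ofReal_mul_I]
  rw [← integral_add_compl (s := Set.Ioi (0:ℝ)) measurableSet_Ioi hi, Set.compl_Ioi]
  have e1 : ∫ y in Set.Ioi (0:ℝ), cexp (-(t * I) * y) * cexp (-a * |y|) =
      ∫ y in Set.Ioi (0:ℝ), cexp ((-(a + t * I)) * y) := by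
    refine setIntegral_congr_fun measurableSet_Ioi (fun y hy ↦ ?_)
    simp only [abs_of_pos (Set.mem_Ioi.1 hy), ← Complex.exp_add]
    ring_nf
  have e2 : ∫ y in Set.Iic (0:ℝ), cexp (-(t * I) * y) * cexp (-a * |y|) =
      ∫ y in Set.Iic (0:ℝ), cexp ((a - t * I) * y) := by
    refine setIntegral_congr_fun measurableSet_Iic (fun y hy ↦ ?_)
    simp only [abs_of_nonpos (Set.mem_Iic.1 hy), ← Complex.exp_add]
    push_cast
    ring_nf
  rw [e1, e2, integral_exp_mul_complex_Ioi (by simpa), integral_exp_mul_complex_Iic (by simpa)]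
  have : (t:ℂ)^2 + a^2 = (a + t * I) * (a - t * I) := by
    ring_nf; simp
  have h0 := denom_ne9 ha t
  rw [this] at h0 ⊢
  have h1 := left_ne_zero_of_mul h0
  have h2 := right_ne_zero_of_mul h0
  simp only [ofReal_zero, mul_zero, Complex.exp_zero]
  have h3 : -(a + t * I) ≠ 0 := neg_ne_zero.2 h1
  rw [show (-1 : ℂ) / -(a + t * I) = 1 / (a + t * I) by rw [neg_div_neg_eq]]
  field_simp
  ring

lemma lor_int9 {a : ℂ} (ha : 0 < a.re) : Integrable (fun t : ℝ ↦ 1 / ((t:ℂ)^2 + a^2)) := by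
  have hcont : Continuous (fun t : ℝ ↦ 1 / ((t:ℂ)^2 + a^2)) :=
    Continuous.div (by fun_prop) (by fun_prop) (denom_ne9 ha)
  refine hcont.locallyIntegrable.integrable_of_isBigO_cocompact (g := fun t : ℝ ↦ (1 + t^2)⁻¹) ?_
    (integrable_inv_one_add_sq.integrableAtFilter _)
  refine Asymptotics.IsBigO.of_bound 2 ?_
  have : ∀ᶠ t : ℝ in Filter.cocompact ℝ, 2 * ‖a‖^2 + 1 ≤ ‖t‖ ^ 2 :=
    ((Filter.tendsto_pow_atTop two_ne_zero).comp (tendsto_norm_cocompact_atTop)).eventually_ge_atTop _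
  filter_upwards [this] with t ht
  simp only [one_div, norm_inv]
  have h1 : ‖t‖^2 - ‖a‖^2 ≤ ‖(t:ℂ)^2 + a^2‖ := by
    have := norm_sub_le_norm_add ((t:ℂ)^2) (a^2)
    simpa using this
  have h2 : ‖1 + t^2‖ = 1 + ‖t‖^2 := by
    rw [Real.norm_of_nonneg (by positivity)]; simp
  rw [h2, ← div_eq_mul_inv, inv_le_comm₀ (by have := sq_nonneg ‖a‖; linarith) (by positivity), inv_div]
  linarith

lemma fourier9 {a : ℂ} (ha : 0 < a.re) (y : ℝ) :
    ∫ t : ℝ, cexp (t * y * I) / ((t:ℂ)^2 + a^2) = π / a * cexp (-a * |y|) := by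
  have ha0 : a ≠ 0 := by rintro rfl; simp at ha
  set f : ℝ → ℂ := fun y ↦ cexp (-a * |y|) with hf
  have hcf : Continuous f := by fun_prop
  have hF : FourierTransform.fourier f = fun w : ℝ ↦ 2 * a / (((2 * π * w : ℝ):ℂ)^2 + a^2) := by
    ext w
    rw [Real.fourier_real_eq_integral_exp_smul, ← expabs_ft9 ha]
    refine integral_congr_ae (.of_forall fun v ↦ ?_)
    simp only [smul_eq_mul, hf]
    congr 2
    push_cast
    ring
  have hG : Integrable (fun w : ℝ ↦ 2 * a / (((2 * π * w : ℝ):ℂ)^2 + a^2)) := by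
    have := ((lor_int9 ha).comp_mul_left' (R := 2 * π) (by positivity)).const_mul (2 * a)
    refine this.congr (.of_forall fun w ↦ ?_)
    simp [div_eq_mul_inv]
  have hinv := congrFun (hcf.fourierInv_fourier_eq (expabs_int9 ha) (hF ▸ hG)) y
  rw [hF, Real.fourierInv_eq'] at hinv
  have h5 := Measure.integral_comp_mul_left (fun t : ℝ ↦ cexp (t * y * I) / ((t:ℂ)^2 + a^2)) (2 * π)
  have h6 : ∫ v : ℝ, cexp (((2 * π * inner ℝ v y : ℝ) : ℂ) * I) •
      (2 * a / (((2 * π * v : ℝ):ℂ)^2 + a^2)) = 2 * a *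
      ∫ x : ℝ, (fun t : ℝ ↦ cexp (t * y * I) / ((t:ℂ)^2 + a^2)) (2 * π * x) := by
    rw [← integral_const_mul]
    refine integral_congr_ae (.of_forall fun v ↦ ?_)
    simp only [smul_eq_mul, RCLike.inner_apply, conj_trivial]
    push_cast
    ring_nf
  rw [h6, h5, abs_of_pos (by positivity)] at hinv
  have hpi : (π:ℂ) ≠ 0 := by exact_mod_cast Real.pi_ne_zero
  rw [show cexp (-a * |y|) = f y from rfl, ← hinv]
  rw [Complex.real_smul]
  generalize (∫ t : ℝ, cexp (t * y * I) / ((t:ℂ)^2 + a^2)) = J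
  push_cast
  field_simp

lemma cpow_exp9 {x : ℝ} (hx : 0 < x) (w : ℂ) : (x:ℂ) ^ w = cexp (Real.log x * w) := by
  rw [Complex.cpow_def_of_ne_zero (by exact_mod_cast hx.ne'), Complex.ofReal_log hx.le]

lemma upper_eq9 (z : ℂ) {r : ℝ} (hr : 0 < r) :
    upperGamma z r = (r:ℂ) ^ z * ∫ x in Set.Ioi (1:ℝ), (x:ℂ) ^ (z - 1) * cexp (-(r * x)) := by
  have h := integral_comp_mul_left_Ioi' (fun t : ℝ ↦ (t:ℂ) ^ (z - 1) * cexp (-t)) 1 hr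
  rw [mul_one] at h
  unfold upperGamma
  rw [← h, ← integral_const_mul, ← integral_smul]
  refine setIntegral_congr_fun measurableSet_Ioi (fun x hx ↦ ?_)
  have hx : 0 < x := lt_trans one_pos hx
  simp only [Complex.real_smul]
  rw [cpow_exp9 (mul_pos hr hx), cpow_exp9 hr, cpow_exp9 hx, Real.log_mul hr.ne' hx.ne']
  nth_rewrite 1 [← Real.exp_log hr]
  push_cast
  simp only [← Complex.exp_add]
  congr 1
  ring

lemma term_eq9 (s : ℂ) {n : ℝ} (hn : 0 < n) :
    (π : ℂ) ^ (-s / 2) * ((n : ℂ) ^ (-s) * upperGamma (s / 2) (π * n ^ 2)) =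
    ∫ x in Set.Ioi (1:ℝ), (x:ℂ) ^ (s / 2 - 1) * cexp (-((π * n ^ 2 : ℝ) * x)) := by
  have hr : 0 < π * n ^ 2 := by positivity
  rw [upper_eq9 _ hr, ← mul_assoc, ← mul_assoc]
  convert one_mul _
  rw [cpow_exp9 Real.pi_pos, cpow_exp9 hn, cpow_exp9 hr, Real.log_mul Real.pi_ne_zero (by positivity),
    Real.log_pow, ← Complex.exp_add, ← Complex.exp_add, Complex.exp_eq_one_iff]
  refine ⟨0, ?_⟩
  push_cast
  ring

lemma exp_int9 {r : ℝ} (hr : 0 < r) {σ : ℝ} (hσ : 0 < σ) :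
    IntegrableOn (fun x : ℝ ↦ x ^ (σ - 1) * Real.exp (-(r * x))) (Set.Ioi 0) := by
  by_contra h
  have h1 := Real.integral_rpow_mul_exp_neg_mul_Ioi hσ hr
  rw [integral_undef h] at h1
  have : 0 < (1 / r) ^ σ * Real.Gamma σ := mul_pos (by positivity) (Real.Gamma_pos_of_pos hσ)
  linarith

lemma phi_sum9 {x : ℝ} (hx : 0 < x) :
    HasSum (fun n : ℕ ↦ cexp (-((π * ((n:ℝ) + 1) ^ 2 : ℝ) * x))) (phi9 x / 2) := by
  have h := HurwitzZeta.hasSum_nat_cosKernel₀ 0 hx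
  have h2 := (Complex.hasSum_ofReal.2 h).div_const 2
  simp only [mul_zero, zero_mul, Real.cos_zero, mul_one] at h2
  have e1 : phi9 x / 2 = ((HurwitzZeta.cosKernel (0:ℝ) x - 1 : ℝ) : ℂ) / 2 := by
    simp [phi9, HurwitzZeta.evenKernel_eq_cosKernel_of_zero]
  rw [e1]
  refine h2.congr_fun (fun n ↦ ?_)
  push_cast
  rw [mul_div_cancel_left₀ _ two_ne_zero]
  congr 1
  ring

lemma sum_eq9 (s : ℂ) (hs : 1 < s.re) :
    (π : ℂ) ^ (-s / 2) * ∑' n : ℕ+, (n : ℂ) ^ (-s) * upperGamma (s / 2) (π * n ^ 2)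
      = M9 (s / 2) / 2 := by
  set F : ℕ → ℝ → ℂ := fun n x ↦ (x:ℂ) ^ (s / 2 - 1) * cexp (-((π * ((n:ℝ) + 1) ^ 2 : ℝ) * x))
  have hnorm : ∀ n : ℕ, ∀ x ∈ Set.Ioi (0:ℝ), ‖F n x‖ =
      x ^ (s.re / 2 - 1) * Real.exp (-((π * ((n:ℝ) + 1) ^ 2) * x)) := by
    intro n x hx
    have e : (-((π * ((n:ℝ) + 1) ^ 2 : ℝ) * x) : ℂ) = ((-((π * ((n:ℝ) + 1) ^ 2) * x) : ℝ) : ℂ) := by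
      push_cast; ring
    simp only [F]
    rw [norm_mul, Complex.norm_cpow_eq_rpow_re_of_pos hx, e, Complex.norm_exp_ofReal]
    simp
  have hI0 : ∀ n : ℕ, IntegrableOn (fun x ↦ ‖F n x‖) (Set.Ioi 0) := fun n ↦
    (exp_int9 (by positivity) (by linarith : 0 < s.re / 2)).congr_fun
      (fun x hx ↦ (hnorm n x hx).symm) measurableSet_Ioi
  have hmeas : ∀ n : ℕ, AEStronglyMeasurable (F n) (volume.restrict (Set.Ioi 0)) := by
    intro n
    refine ContinuousOn.aestronglyMeasurable (fun x hx ↦ ?_) measurableSet_Ioi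
    refine ContinuousAt.continuousWithinAt ?_
    refine ContinuousAt.mul ?_ (by fun_prop)
    exact Complex.continuousAt_ofReal_cpow_const _ _ (Or.inr (ne_of_gt hx))
  have hsub : Set.Ioi (1:ℝ) ⊆ Set.Ioi 0 := Set.Ioi_subset_Ioi zero_le_one
  have hI : ∀ n : ℕ, IntegrableOn (F n) (Set.Ioi 0) := fun n ↦
    (integrable_norm_iff (hmeas n)).1 (hI0 n)
  have hsum : Summable fun n : ℕ ↦ ∫ x in Set.Ioi (1:ℝ), ‖F n x‖ := by
    have hb : Summable fun n : ℕ ↦ (1 / (π * ((n:ℝ) + 1) ^ 2)) ^ (s.re/2) * Real.Gamma (s.re/2) := by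
      refine Summable.mul_right _ ?_
      have h1 := ((summable_nat_add_iff 1).2 (Real.summable_one_div_nat_rpow.2 hs)).mul_left
        ((1/π) ^ (s.re/2))
      refine h1.congr (fun n ↦ ?_)
      have h2 : (((n + 1 : ℕ) : ℝ)) ^ s.re = ((((n:ℝ) + 1) ^ 2)) ^ (s.re / 2) := by
        rw [← Real.rpow_natCast ((n:ℝ) + 1) 2, ← Real.rpow_mul (by positivity)]
        push_cast
        congr 1
        ring
      rw [h2, Real.div_rpow zero_le_one (by positivity), Real.div_rpow zero_le_one (by positivity),
        Real.mul_rpow (by positivity) (by positivity), Real.one_rpow, one_div_mul_one_div]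
    refine hb.of_nonneg_of_le (fun n ↦ integral_nonneg fun x ↦ norm_nonneg _) (fun n ↦ ?_)
    rw [← Real.integral_rpow_mul_exp_neg_mul_Ioi (by linarith : 0 < s.re / 2) (by positivity),
      ← setIntegral_congr_fun measurableSet_Ioi (hnorm n)]
    exact setIntegral_mono_set (hI0 n) (.of_forall fun x ↦ norm_nonneg _) hsub.eventuallyLE
  have key := (hasSum_integral_of_summable_integral_norm (fun n ↦ (hI n).mono_set hsub) hsum).tsum_eq
  have e1 := tsum_pnat_eq_tsum_succ (f := fun n : ℕ ↦ (n : ℂ) ^ (-s) * upperGamma (s / 2) (π * n ^ 2))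
  rw [e1, ← tsum_mul_left]
  have e2 : ∀ n : ℕ, (π : ℂ) ^ (-s / 2) * (((n + 1 : ℕ) : ℂ) ^ (-s) * upperGamma (s / 2) (π * (n + 1 : ℕ) ^ 2))
      = ∫ x in Set.Ioi (1:ℝ), F n x := by
    intro n
    have := term_eq9 s (n := (n:ℝ) + 1) (by positivity)
    simp only [F]
    rw [← this]
    push_cast
    rfl
  rw [tsum_congr e2, key, M9, ← integral_div]
  refine setIntegral_congr_fun measurableSet_Ioi (fun x hx ↦ ?_)
  simp only [F]
  rw [tsum_mul_left, (phi_sum9 (hsub hx)).tsum_eq]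
  ring

lemma xi_eq9 {s : ℂ} (hs : 0 < s.re) : xi s = s * (s - 1) / 2 * completedRiemannZeta s := by
  have h0 : s ≠ 0 := by rintro rfl; simp at hs
  have hG := Complex.Gammaℝ_ne_zero_of_re_pos hs
  have : (π : ℂ) ^ (-s / 2) * Complex.Gamma (s / 2) = Complex.Gammaℝ s := rfl
  rw [xi, this, riemannZeta_def_of_ne_zero h0, mul_div_cancel₀ _ hG]

lemma half_line9 {H : ℝ → ℂ} (hH : Integrable H) :
    ∫ t in Set.Ioi (0:ℝ), (H t + H (-t)) = ∫ t, H t := by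
  rw [integral_add hH.integrableOn hH.comp_neg.integrableOn, integral_comp_neg_Ioi, neg_zero,
    ← integral_add_compl (s := Set.Ioi (0:ℝ)) measurableSet_Ioi hH, Set.compl_Ioi]

noncomputable def G9 (a : ℂ) (t : ℝ) : ℂ := M9 (1/4 + t/2 * I) / ((t:ℂ)^2 + a^2)

lemma prod_int9 {a : ℂ} (ha : 0 < a.re) :
    Integrable (Function.uncurry fun (t x : ℝ) ↦
      cexp (t * (Real.log x / 2 : ℝ) * I) *
        (1 / ((t:ℂ)^2 + a^2) * ((x:ℂ) ^ ((1/4:ℂ) - 1) * phi9 x)))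
      (volume.prod (volume.restrict (Set.Ioi (1:ℝ)))) := by
  have h := (lor_int9 ha).mul_prod (phi_int9 (1/4))
  refine h.bdd_mul (c := 1) ?_ (.of_forall fun p ↦ ?_)
  · refine Measurable.aestronglyMeasurable ?_
    fun_prop
  · rw [← Complex.ofReal_mul, Complex.norm_exp_ofReal_mul_I]

lemma G_eq9 (a : ℂ) (t : ℝ) : G9 a t = ∫ x in Set.Ioi (1:ℝ),
    cexp (t * (Real.log x / 2 : ℝ) * I) *
        (1 / ((t:ℂ)^2 + a^2) * ((x:ℂ) ^ ((1/4:ℂ) - 1) * phi9 x)) := by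
  rw [G9, M9, ← integral_div]
  refine setIntegral_congr_fun measurableSet_Ioi (fun x hx ↦ ?_)
  have hx : 0 < x := lt_trans one_pos hx
  have : (x:ℂ) ^ ((1/4 + t/2 * I : ℂ) - 1) =
      cexp (t * (Real.log x / 2 : ℝ) * I) * (x:ℂ) ^ ((1/4:ℂ) - 1) := by
    rw [cpow_exp9 hx, cpow_exp9 hx, ← Complex.exp_add]
    congr 1
    push_cast
    ring
  simp only [this]
  ring

lemma G_int9 {a : ℂ} (ha : 0 < a.re) : Integrable (G9 a) := by
  have := (prod_int9 ha).integral_prod_left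
  refine this.congr (.of_forall fun t ↦ ?_)
  rw [G_eq9]
  rfl

lemma G_integral9 {a : ℂ} (ha : 0 < a.re) : ∫ t, G9 a t = π / a * M9 (1/4 - a/2) := by
  simp_rw [G_eq9]
  rw [integral_integral_swap (prod_int9 ha), M9, ← integral_const_mul]
  refine setIntegral_congr_fun measurableSet_Ioi (fun x hx ↦ ?_)
  have hx0 : 0 < x := lt_trans one_pos hx
  have hl : 0 < Real.log x / 2 := by have := Real.log_pos hx; linarith
  have e : ∀ t : ℝ, cexp (t * (Real.log x / 2 : ℝ) * I) *
        (1 / ((t:ℂ)^2 + a^2) * ((x:ℂ) ^ ((1/4:ℂ) - 1) * phi9 x)) =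
        cexp (t * (Real.log x / 2 : ℝ) * I) / ((t:ℂ)^2 + a^2) * ((x:ℂ) ^ ((1/4:ℂ) - 1) * phi9 x) := by
    intro t; ring
  simp only [e]
  rw [integral_mul_const, fourier9 ha, abs_of_pos hl]
  have : (x:ℂ) ^ ((1/4 - a/2 : ℂ) - 1) =
      cexp (-a * (Real.log x / 2 : ℝ)) * (x:ℂ) ^ ((1/4:ℂ) - 1) := by
    rw [cpow_exp9 hx0, cpow_exp9 hx0, ← Complex.exp_add]
    congr 1
    push_cast
    ring
  simp only [this]
  ring

lemma lor_integral9 {a : ℂ} (ha : 0 < a.re) : ∫ t : ℝ, 1 / ((t:ℂ)^2 + a^2) = π / a := by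
  simpa using fourier9 ha 0

theorem stmt9 (s : ℂ) (hs : 1 < s.re) :
    (s - 1 / 2) * ∫ t in Set.Ioi (0 : ℝ),
        xi (1 / 2 + t * I) / (((t : ℂ) ^ 2 + 1 / 4) * ((t : ℂ) ^ 2 + (s - 1 / 2) ^ 2))
      = π / 2 * (1 / (s - 1) - 2 * xi s / (s * (s - 1))
          + (π : ℂ) ^ (-s / 2) * ∑' n : ℕ+, (n : ℂ) ^ (-s) * upperGamma (s / 2) (π * n ^ 2)) := by
  have hs0 : s ≠ 0 := by rintro rfl; simp at hs; linarith
  have hs1 : s - 1 ≠ 0 := by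
    intro h; rw [sub_eq_zero] at h; subst h; simp at hs
  have ha : 0 < (s - 1/2).re := by simp; linarith
  obtain ⟨a, rfl⟩ : ∃ a, s = a + 1/2 := ⟨s - 1/2, by ring⟩
  have ha0 : a ≠ 0 := by rintro rfl; simp at ha
  rw [add_sub_cancel_right] at ha
  simp only [add_sub_cancel_right]
  have hb : 0 < (1/2 : ℂ).re := by norm_num
  have hd : a^2 - (1/2)^2 ≠ 0 := by
    rw [show a^2 - (1/2)^2 = (a + 1/2) * (a + 1/2 - 1) by ring]; exact mul_ne_zero hs0 hs1
  set H : ℝ → ℂ := fun t ↦ -(1/4) * G9 a t + (1/4) / (a^2 - (1/2)^2) *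
    (1 / ((t:ℂ)^2 + (1/2)^2) - 1 / ((t:ℂ)^2 + a^2)) with hHdef
  have hH1 : Integrable (fun t : ℝ ↦ 1 / ((t:ℂ)^2 + (1/2)^2) - 1 / ((t:ℂ)^2 + a^2)) :=
    (lor_int9 hb).sub (lor_int9 ha)
  have hH : Integrable H := ((G_int9 ha).const_mul _).add (hH1.const_mul _)
  have hHI : ∫ t, H t = -(1/4) * (π / a * M9 (1/4 - a/2)) + (1/4) / (a^2 - (1/2)^2) *
      (π / (1/2) - π / a) := by
    rw [hHdef, integral_add ((G_int9 ha).const_mul _) (hH1.const_mul _), integral_const_mul,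
      integral_const_mul, integral_sub (lor_int9 hb) (lor_int9 ha), G_integral9 ha,
      lor_integral9 hb, lor_integral9 ha]
  have hint : ∫ t in Set.Ioi (0 : ℝ),
        xi (1 / 2 + t * I) / (((t : ℂ) ^ 2 + 1 / 4) * ((t : ℂ) ^ 2 + a ^ 2)) = ∫ t, H t := by
    rw [← half_line9 hH]
    refine setIntegral_congr_fun measurableSet_Ioi (fun t _ ↦ ?_)
    have hre : 0 < (1/2 + t * I : ℂ).re := by simp
    have d1 := denom_ne9 hb t
    have d2 := denom_ne9 ha t
    have I2 : I^2 = -1 := Complex.I_sq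
    have f1 : (1/2 + t * I : ℂ) * ((1/2 + t * I) - 1) = -((t:ℂ)^2 + (1/2)^2) := by
      linear_combination (t:ℂ)^2 * I2
    have n1 : (1/2 + t * I : ℂ) ≠ 0 := by intro h; rw [h] at f1; simp at f1; apply d1; linear_combination f1
    have n2 : (1 - (1/2 + t * I) : ℂ) ≠ 0 := by
      intro h
      rw [show (1/2 + t * I : ℂ) - 1 = 0 by linear_combination -h] at f1
      apply d1; linear_combination f1
    have f2 : 1 / (1/2 + t * I : ℂ) + 1 / (1 - (1/2 + t * I)) = 1 / ((t:ℂ)^2 + (1/2)^2) := by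
      rw [div_add_div _ _ n1 n2, div_eq_div_iff (mul_ne_zero n1 n2) d1]
      linear_combination f1
    have f3 : completedRiemannZeta (1/2 + t * I) =
        (M9 (1/4 + t/2 * I) + M9 (1/4 + (-t:ℝ)/2 * I)) / 2 - 1 / ((t:ℂ)^2 + (1/2)^2) := by
      rw [completedRiemannZeta_eq, Lambda0_eq9, sub_sub, f2]
      congr 4
      · ring
      · push_cast; ring
    simp only [hHdef, G9]
    rw [xi_eq9 hre, f1, f3]
    push_cast
    rw [show (1/4 : ℂ) = (1/2)^2 by norm_num, neg_sq]
    generalize M9 ((1/2)^2 + t/2 * I) = X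
    generalize M9 ((1/2)^2 + -t/2 * I) = Y
    generalize hu : (t:ℂ)^2 + (1/2)^2 = u at *
    generalize hv : (t:ℂ)^2 + a^2 = v at *
    have huv : a^2 - (1/2)^2 = v - u := by rw [← hu, ← hv]; ring
    rw [huv] at hd ⊢
    field_simp
    ring
  rw [hint, hHI, sum_eq9 _ hs, xi_eq9 (by linarith), completedRiemannZeta_eq, Lambda0_eq9,
    show (1 - (a + 1/2))/2 = 1/4 - a/2 by ring]
  generalize M9 ((a + 1/2)/2) = X
  generalize M9 (1/4 - a/2) = Y
  have h3 : 1 - (a + 1/2) ≠ 0 := by intro h; apply hs1; linear_combination -h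
  have e1 : 1 / (1 - (a + 1/2)) = - (1 / (a + 1/2 - 1)) := by
    rw [← neg_sub, div_neg]
  rw [e1, show a^2 - (1/2)^2 = (a + 1/2) * (a + 1/2 - 1) by ring]
  generalize hv : a + 1/2 - 1 = v at *
  generalize hu : a + 1/2 = u at *
  have ea : a = v + 1/2 := by rw [← hv, ← hu]; ring
  have eu : u = v + 1 := by rw [← hv]; ring
  subst eu
  have ha2 : 2 * a = 2 * v + 1 := by rw [ea]; ring
  have ha3 : 2 * v + 1 ≠ 0 := by rw [← ha2]; exact mul_ne_zero two_ne_zero ha0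
  rw [show a = (2 * v + 1) / 2 by rw [ea]; ring]
  field_simp
  ring
end

section
/- For x real, ∫₀^∞ λ(t)/(t² + 1/4) · cos(xt) dt = (π/2)(e^(x/2) − 2 e^(-x/2) ψ(e^(-2x))), where λ(t) = ξ(1/2 + it) and ψ(x) = ∑_{n≥1} e^(-π n² x). -/
open MeasureTheory Real Complex

open scoped FourierTransform

noncomputable def GG (z : ℂ) : ℂ :=
  cexp (z / 4) * (jacobiTheta (I * cexp z) - 1 - cexp (-z / 2))

lemma GG_im (z : ℂ) (hz : |z.im| ≤ 1) : Real.exp z.re / 2 ≤ (I * cexp z).im := by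
  have h1 : (I * cexp z).im = Real.exp z.re * Real.cos z.im := by
    simp [Complex.exp_re]
  have h2 : (1:ℝ) / 2 ≤ Real.cos z.im := by
    have := Real.one_sub_sq_div_two_le_cos (x := z.im)
    have h3 : z.im ^ 2 ≤ 1 := (sq_le_one_iff_abs_le_one _).2 hz
    linarith
  rw [h1]
  have := Real.exp_pos z.re
  nlinarith

lemma GG_im_pos (z : ℂ) (hz : |z.im| ≤ 1) : 0 < (I * cexp z).im :=
  lt_of_lt_of_le (by positivity) (GG_im z hz)

lemma GG_diff (z : ℂ) (hz : |z.im| ≤ 1) : DifferentiableAt ℂ GG z := by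
  have h := differentiableAt_jacobiTheta (GG_im_pos z hz)
  have h2 : DifferentiableAt ℂ (fun z : ℂ => jacobiTheta (I * cexp z)) z :=
    DifferentiableAt.comp (f := fun z : ℂ => I * cexp z) z h (by fun_prop)
  unfold GG
  fun_prop

lemma GG_even (z : ℂ) (hz : |z.im| ≤ 1) : GG (-z) = GG z := by
  have hp := pi_gt_three
  have hab := abs_le.1 hz
  have h := jacobiTheta₂_functional_equation 0 (I * cexp z)
  have e1 : -I * (I * cexp z) = cexp z := by
    rw [← mul_assoc]; simp
  have e2 : -1 / (I * cexp z) = I * cexp (-z) := by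
    rw [Complex.exp_neg]
    have := Complex.exp_ne_zero z
    field_simp
    simp
  have e3 : (cexp z) ^ (1 / 2 : ℂ) = cexp (z / 4) * cexp (z / 4) := by
    rw [cpow_def_of_ne_zero (Complex.exp_ne_zero z),
      Complex.log_exp (by linarith) (by linarith), ← Complex.exp_add]
    congr 1; ring
  rw [e1, e2, e3] at h
  simp only [zero_div, ← jacobiTheta_eq_jacobiTheta₂] at h
  unfold GG
  rw [h]
  have e4 : cexp (-z / 4) = (cexp (z / 4))⁻¹ := by rw [← Complex.exp_neg]; congr 1; ring
  have e5 : cexp (-z / 2) = (cexp (z / 4))⁻¹ * (cexp (z / 4))⁻¹ := by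
    rw [← Complex.exp_neg, ← Complex.exp_add]; congr 1; ring
  have e6 : cexp (- -z / 2) = (cexp (z / 4)) * (cexp (z / 4)) := by
    rw [← Complex.exp_add]; congr 1; ring
  rw [e4, e5, e6]
  have := Complex.exp_ne_zero (z / 4)
  simp
  field_simp
  ring

lemma GG_bound0 : ∃ C : ℝ, 0 < C ∧ ∀ z : ℂ, |z.im| ≤ 1 → 0 ≤ z.re →
    ‖GG z‖ ≤ C * Real.exp (-z.re / 4) := by
  have hp := pi_gt_three
  have hlt : Real.exp (-π / 2) < 1 := by rw [Real.exp_lt_one_iff]; linarith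
  refine ⟨2 / (1 - Real.exp (-π / 2)) + 1, ?_, ?_⟩
  · have : 0 < 1 - Real.exp (-π / 2) := by linarith
    positivity
  intro z hz hre
  have h1 := norm_jacobiTheta_sub_one_le (GG_im_pos z hz)
  have h2 := GG_im z hz
  have hx := Real.add_one_le_exp z.re
  have h3 : Real.exp (-π * (I * cexp z).im) ≤ Real.exp (-π / 2) := by
    apply Real.exp_le_exp.2
    have : (1:ℝ)/2 ≤ (I * cexp z).im := by linarith
    nlinarith
  have h4 : Real.exp (-π * (I * cexp z).im) ≤ Real.exp (-z.re / 2) := by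
    apply Real.exp_le_exp.2
    have : z.re / 2 ≤ (I * cexp z).im := by linarith
    nlinarith
  have h5 : ‖jacobiTheta (I * cexp z) - 1‖ ≤ 2 / (1 - Real.exp (-π / 2)) * Real.exp (-z.re / 2) := by
    refine h1.trans ?_
    have : 0 < 1 - Real.exp (-π / 2) := by linarith
    gcongr
  have h6 : ‖cexp (-z / 2)‖ = Real.exp (-z.re / 2) := by
    rw [Complex.norm_exp]; simp
  have h7 : ‖cexp (z / 4)‖ = Real.exp (z.re / 4) := by
    rw [Complex.norm_exp]; simp
  unfold GG
  rw [norm_mul, h7]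
  calc _ ≤ Real.exp (z.re / 4) * (2 / (1 - Real.exp (-π / 2)) * Real.exp (-z.re / 2) + Real.exp (-z.re / 2)) := by
        gcongr
        refine (norm_sub_le _ _).trans ?_
        rw [h6]; gcongr
    _ = (2 / (1 - Real.exp (-π / 2)) + 1) * (Real.exp (z.re / 4) * Real.exp (-z.re / 2)) := by ring
    _ = _ := by rw [← Real.exp_add]; congr 2; ring

lemma GG_bound : ∃ C : ℝ, 0 < C ∧ ∀ z : ℂ, |z.im| ≤ 1 →
    ‖GG z‖ ≤ C * Real.exp (-|z.re| / 4) := by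
  obtain ⟨C, hC, h⟩ := GG_bound0
  refine ⟨C, hC, fun z hz => ?_⟩
  rcases le_total 0 z.re with h0 | h0
  · rw [abs_of_nonneg h0]; exact h z hz h0
  · rw [abs_of_nonpos h0, ← GG_even z hz]
    simpa using h (-z) (by simpa using hz) (by simpa using h0)

lemma GG_deriv_bound (n : ℕ) : ∃ C : ℝ, ∀ u : ℝ,
    ‖iteratedDeriv n GG (u : ℂ)‖ ≤ C * Real.exp (-|u| / 4) := by
  obtain ⟨C, hC, h⟩ := GG_bound
  refine ⟨n.factorial * (C * Real.exp (1 / 4)), fun u => ?_⟩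
  have hball : ∀ z ∈ Metric.closedBall (u : ℂ) 1, |z.im| ≤ 1 := by
    intro z hz
    have h1 := Complex.abs_im_le_norm (z - u)
    rw [Metric.mem_closedBall, dist_eq_norm] at hz
    simp at h1
    linarith
  have key := Complex.norm_iteratedDeriv_le_of_forall_mem_sphere_norm_le (c := (u : ℂ)) (R := 1)
    (C := C * Real.exp (1 / 4) * Real.exp (-|u| / 4)) (f := GG) n one_pos ?_ ?_
  · refine key.trans (le_of_eq ?_)
    simp; ring
  · apply DifferentiableOn.diffContOnCl
    rw [closure_ball _ one_ne_zero]
    exact fun z hz => (GG_diff z (hball z hz)).differentiableWithinAt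
  · intro z hz
    refine (h z (hball z (Metric.sphere_subset_closedBall hz))).trans ?_
    rw [mul_assoc, ← Real.exp_add]
    gcongr
    have h1 := Complex.abs_re_le_norm (z - u)
    rw [Metric.mem_sphere, dist_eq_norm] at hz
    simp at h1
    have := abs_sub_abs_le_abs_sub u z.re
    rw [abs_sub_comm] at this
    linarith

lemma integrable_exp_abs : Integrable (fun u : ℝ => Real.exp (-|u| / 4)) := by
  have h1 : IntegrableOn (fun u : ℝ => Real.exp (-|u| / 4)) (Set.Ioi 0) := by
    have := integrableOn_exp_mul_Ioi (a := -1/4) (by norm_num) 0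
    refine this.congr_fun (fun u hu => ?_) measurableSet_Ioi
    simp only []
    rw [abs_of_pos hu]; congr 1; ring
  have h2 : IntegrableOn (fun u : ℝ => Real.exp (-|u| / 4)) (Set.Iic 0) := by
    have := integrableOn_exp_mul_Iic (a := 1/4) (by norm_num) 0
    refine this.congr_fun (fun u hu => ?_) measurableSet_Iic
    simp only []
    rw [abs_of_nonpos hu]; congr 1; ring
  rw [← integrableOn_univ, ← Set.Iic_union_Ioi (a := (0:ℝ))]
  exact h2.union h1

lemma GG_analytic (u : ℝ) : AnalyticAt ℂ GG u := by
  rw [Complex.analyticAt_iff_eventually_differentiableAt]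
  have : ∀ᶠ z : ℂ in nhds (u:ℂ), |z.im| < 1 := by
    have hc : Continuous (fun z : ℂ => |z.im|) := by fun_prop
    exact hc.continuousAt.eventually_lt continuousAt_const (by simp)
  exact this.mono fun z hz => GG_diff z hz.le

noncomputable def gg (u : ℝ) : ℂ := GG u

lemma hasDeriv_iter (n : ℕ) (u : ℝ) : HasDerivAt (fun u : ℝ => iteratedDeriv n GG (u : ℂ))
    (iteratedDeriv (n+1) GG u) u := by
  apply HasDerivAt.comp_ofReal
  rw [iteratedDeriv_succ]
  have := AnalyticAt.iterated_deriv (GG_analytic u) n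
  rw [← iteratedDeriv_eq_iterate] at this
  exact this.differentiableAt.hasDerivAt

lemma integrable_iter (n : ℕ) : Integrable (fun u : ℝ => iteratedDeriv n GG (u : ℂ)) := by
  obtain ⟨C, h⟩ := GG_deriv_bound n
  refine (integrable_exp_abs.const_mul C).mono' ?_ (Filter.Eventually.of_forall h)
  apply Continuous.aestronglyMeasurable
  exact continuous_iff_continuousAt.2 fun u => (hasDeriv_iter n u).continuousAt

lemma gg_eq : gg = fun u : ℝ => iteratedDeriv 0 GG (u : ℂ) := by
  ext u; simp [gg]

lemma gg_cont : Continuous gg := by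
  rw [gg_eq]
  exact continuous_iff_continuousAt.2 fun u => (hasDeriv_iter 0 u).continuousAt

lemma gg_int : Integrable gg := by rw [gg_eq]; exact integrable_iter 0

lemma fourier_iter (n : ℕ) (w : ℝ) : 𝓕 (fun u : ℝ => iteratedDeriv (n+1) GG (u : ℂ)) w =
    (2 * π * I * w) * 𝓕 (fun u : ℝ => iteratedDeriv n GG (u : ℂ)) w := by
  have hd : deriv (fun u : ℝ => iteratedDeriv n GG (u : ℂ)) =
      fun u : ℝ => iteratedDeriv (n+1) GG (u : ℂ) := funext fun u => (hasDeriv_iter n u).deriv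
  have := Real.fourier_deriv (integrable_iter n) (fun u => (hasDeriv_iter n u).differentiableAt)
    (by rw [hd]; exact integrable_iter (n+1))
  rw [hd] at this
  rw [this]; simp

lemma fourier_gg_int : Integrable (𝓕 gg) := by
  have hb : ∀ (f : ℝ → ℂ) (w : ℝ), ‖𝓕 f w‖ ≤ ∫ v, ‖f v‖ := fun f w =>
    VectorFourier.norm_fourierIntegral_le_integral_norm _ _ _ f w
  have h0 := hb gg
  have h2 := hb (fun u : ℝ => iteratedDeriv 2 GG (u : ℂ))
  set A := ∫ v, ‖gg v‖
  set B := ∫ v : ℝ, ‖iteratedDeriv 2 GG (v : ℂ)‖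
  refine (integrable_inv_one_add_sq.const_mul (A + B)).mono' ?_ (Filter.Eventually.of_forall fun w => ?_)
  · apply Continuous.aestronglyMeasurable
    exact VectorFourier.fourierIntegral_continuous Real.continuous_fourierChar
      (by exact continuous_inner) gg_int
  · have h3 := h2 w
    rw [fourier_iter, fourier_iter, ← gg_eq] at h3
    have h4 : ‖(2 * π * I * w : ℂ)‖ = 2 * π * |w| := by
      simp [abs_of_pos pi_pos]
    rw [norm_mul (2 * π * I * w : ℂ), norm_mul (2 * π * I * w : ℂ), h4] at h3
    have h5 : w ^ 2 * ‖𝓕 gg w‖ ≤ B := by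
      refine le_trans ?_ h3
      have : w ^ 2 ≤ (2 * π * |w|) * (2 * π * |w|) := by
        have : (2 * π * |w|) * (2 * π * |w|) = (2 * π) ^ 2 * w ^ 2 := by
          rw [← sq_abs w]; ring
        rw [this]
        have hp := pi_gt_three
        have : 1 ≤ (2 * π) ^ 2 := by nlinarith
        nlinarith [sq_nonneg w]
      rw [← mul_assoc]
      gcongr
    rw [← div_eq_mul_inv, le_div_iff₀ (by positivity)]
    linarith [h0 w]

lemma hasMellin_Ioi (s : ℂ) (h1 : s.re < 1 / 2) :
    HasMellin ((Set.Ioi (1:ℝ)).indicator (fun y : ℝ => (y : ℂ) ^ (-(1 / 2) : ℂ))) s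
      (1 / (1 / 2 - s)) := by
  have hre : (s - 3 / 2).re < -1 := by
    simp; norm_num at h1 ⊢; linarith
  have hi := integrableOn_Ioi_cpow_of_lt hre one_pos
  have hv := integral_Ioi_cpow_of_lt hre one_pos
  have he : (fun t : ℝ => (t : ℂ) ^ (s - 1) •
      (Set.Ioi (1:ℝ)).indicator (fun y : ℝ => (y : ℂ) ^ (-(1 / 2) : ℂ)) t) =
      (Set.Ioi (1:ℝ)).indicator (fun t : ℝ => (t : ℂ) ^ (s - 3 / 2)) := by
    ext t
    by_cases ht : t ∈ Set.Ioi (1:ℝ)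
    · have ht0 : (t : ℂ) ≠ 0 := by
        have : (1:ℝ) < t := ht
        exact_mod_cast (by linarith : (0:ℝ) < t).ne'
      simp only [Set.indicator_of_mem ht, smul_eq_mul]
      rw [← cpow_add _ _ ht0]; congr 1; ring
    · simp [Set.indicator_of_notMem ht]
  constructor
  · unfold MellinConvergent
    rw [he]
    exact ((integrable_indicator_iff measurableSet_Ioi).2 hi).integrableOn
  · unfold mellin
    rw [he, setIntegral_indicator measurableSet_Ioi]
    have : Set.Ioi (0:ℝ) ∩ Set.Ioi 1 = Set.Ioi 1 :=
      Set.inter_eq_right.2 (Set.Ioi_subset_Ioi zero_le_one)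
    rw [this, hv]
    simp only [ofReal_one, one_cpow]
    rw [← neg_div_neg_eq]
    congr 1 <;> ring

lemma theta_kernel (y : ℝ) : ((HurwitzZeta.evenKernel 0 y : ℝ) : ℂ) = jacobiTheta (I * y) := by
  rw [HurwitzZeta.evenKernel_eq_cosKernel_of_zero, jacobiTheta_eq_jacobiTheta₂]
  simpa using HurwitzZeta.cosKernel_def 0 y

lemma mellin_theta (s : ℂ) (h0 : 0 < s.re) (h1 : s.re < 1 / 2) :
    mellin (fun y : ℝ => jacobiTheta (I * y) - 1 - (y : ℂ) ^ (-(1 / 2) : ℂ)) s =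
      (HurwitzZeta.hurwitzEvenFEPair 0).Λ s := by
  have hA := hasMellin_Ioi s h1
  have hB := hasMellin_one_Ioc h0
  have hC : MellinConvergent (HurwitzZeta.hurwitzEvenFEPair 0).f_modif s :=
    ((HurwitzZeta.hurwitzEvenFEPair 0).isStrongFEPair_toStrongFEPair.hasMellin s).1
  have h2 := hasMellin_sub hC hB.1
  have h3 := hasMellin_sub h2.1 hA.1
  have hΛ : (HurwitzZeta.hurwitzEvenFEPair 0).Λ s =
      mellin (HurwitzZeta.hurwitzEvenFEPair 0).f_modif s - 1 / s - 1 / (1 / 2 - s) := by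
    rw [WeakFEPair.Λ, WeakFEPair.Λ₀]
    simp [HurwitzZeta.hurwitzEvenFEPair]
  rw [hΛ, ← hB.2, ← hA.2, ← h2.2, ← h3.2]
  unfold mellin
  apply setIntegral_congr_ae measurableSet_Ioi
  have hne : ∀ᵐ y : ℝ, y ≠ 1 := by
    simp [ae_iff, measure_singleton]
  filter_upwards [hne] with y hy hy0
  congr 1
  have hy0' : (0:ℝ) < y := hy0
  have hpow : ((y ^ (-(1/2) : ℝ) : ℝ) : ℂ) = (y : ℂ) ^ (-(1 / 2) : ℂ) := by
    rw [ofReal_cpow hy0'.le]; simp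
  rcases lt_or_gt_of_ne hy with hlt | hgt
  · simp [WeakFEPair.f_modif, Set.indicator, hlt, hlt.le, hy0', not_lt.2 hlt.le,
      HurwitzZeta.hurwitzEvenFEPair, theta_kernel]
    simp at hpow
    rw [hpow]; ring
  · simp [WeakFEPair.f_modif, Set.indicator, hgt, hgt.le, hy0', not_lt.2 hgt.le, not_le.2 hgt,
      HurwitzZeta.hurwitzEvenFEPair, theta_kernel]

lemma zeta_fourier (t : ℝ) : completedRiemannZeta (1 / 2 + t * I) = 𝓕 gg (t / (4 * π)) / 2 := by
  have hs : ((1 / 2 + t * I : ℂ) / 2).re = 1 / 4 := by simp; norm_num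
  have hs' : ((1 / 2 + t * I : ℂ) / 2).im = t / 2 := by simp
  rw [completedRiemannZeta, HurwitzZeta.completedHurwitzZetaEven,
    ← mellin_theta _ (by rw [hs]; norm_num) (by rw [hs]; norm_num), mellin_eq_fourier, hs, hs']
  have hfun : (fun u : ℝ => Real.exp (-(1 / 4) * u) •
      (jacobiTheta (I * (Real.exp (-u) : ℝ)) - 1 - ((Real.exp (-u) : ℝ) : ℂ) ^ (-(1 / 2) : ℂ))) =
      gg := by
    ext u
    have := GG_even (u : ℂ) (by simp)
    rw [gg, ← this, GG]
    have e1 : ((Real.exp (-u) : ℝ) : ℂ) ^ (-(1 / 2) : ℂ) = cexp (- -u / 2) := by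
      rw [ofReal_exp, cpow_def_of_ne_zero (Complex.exp_ne_zero _), ← ofReal_exp,
        ← ofReal_log (Real.exp_pos _).le, Real.log_exp]
      push_cast
      congr 1; ring
    rw [e1]
    rw [real_smul, ofReal_exp, ofReal_exp]
    push_cast
    congr 2; ring
  rw [hfun]
  congr 2; ring

lemma jpsi_eq (y : ℝ) (hy : 0 < y) : ((jpsi y : ℝ) : ℂ) = (jacobiTheta (I * y) - 1) / 2 := by
  rw [← (hasSum_nat_jacobiTheta (τ := I * y) (by simpa using hy)).tsum_eq, jpsi,
    tsum_pnat_eq_tsum_succ (f := fun n : ℕ => Real.exp (-π * n ^ 2 * y)), ofReal_tsum]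
  congr 1; ext n
  push_cast
  congr 1
  linear_combination (-π * (n + 1) ^ 2 * y : ℂ) * I_sq

lemma xi_eq (t : ℝ) : xi (1 / 2 + t * I) / ((t : ℂ) ^ 2 + 1 / 4) =
    -completedRiemannZeta (1 / 2 + t * I) / 2 := by
  have hs : (1 / 2 + t * I : ℂ) ≠ 0 := by
    intro h; have := congrArg Complex.re h; simp at this
  have hG : Gammaℝ (1 / 2 + t * I) ≠ 0 := Gammaℝ_ne_zero_of_re_pos (by simp)
  have ht : (t : ℂ) ^ 2 + 1 / 4 ≠ 0 := by
    have : (0:ℝ) < t ^ 2 + 1 / 4 := by positivity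
    intro h
    apply this.ne'
    have h' : ((t ^ 2 + 1 / 4 : ℝ) : ℂ) = 0 := by push_cast; exact h
    exact_mod_cast h'
  have h1 : (1 / 2 + t * I : ℂ) * (1 / 2 + t * I - 1) = -((t : ℂ) ^ 2 + 1 / 4) := by
    linear_combination (t : ℂ) ^ 2 * I_sq
  rw [xi, riemannZeta_def_of_ne_zero hs, h1, ← Gammaℝ_def, mul_div_cancel₀ _ hG, div_eq_iff ht]
  ring

lemma line_int : Integrable (fun t : ℝ => completedRiemannZeta (1 / 2 + t * I)) := by
  have := (fourier_gg_int.comp_mul_left' (R := (4 * π)⁻¹) (by positivity)).div_const 2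
  refine this.congr (Filter.Eventually.of_forall fun t => ?_)
  simp only []
  rw [zeta_fourier]; congr 2; field_simp

lemma line_even (t : ℝ) : completedRiemannZeta (1 / 2 + (-t : ℝ) * I) =
    completedRiemannZeta (1 / 2 + t * I) := by
  rw [← completedRiemannZeta_one_sub]
  congr 1; push_cast; ring

lemma line_inv (x : ℝ) : ∫ t : ℝ, completedRiemannZeta (1 / 2 + t * I) * cexp (-(x * t) * I) =
    2 * π * gg (-2 * x) := by
  have h := congrFun (gg_cont.fourierInv_fourier_eq gg_int fourier_gg_int) (-2 * x)
  rw [Real.fourierInv_eq'] at h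
  have h2 := Measure.integral_comp_mul_left
    (fun v : ℝ => cexp (↑(2 * π * inner ℝ v (-2 * x)) * I) • 𝓕 gg v) (4 * π)⁻¹
  rw [h] at h2
  have h3 : ∀ t : ℝ, completedRiemannZeta (1 / 2 + t * I) * cexp (-(x * t) * I) =
      (1 / 2 : ℂ) * (cexp (↑(2 * π * inner ℝ ((4 * π)⁻¹ * t) (-2 * x)) * I) • 𝓕 gg ((4 * π)⁻¹ * t)) := by
    intro t
    rw [zeta_fourier]
    have e1 : 2 * π * inner ℝ ((4 * π)⁻¹ * t) (-2 * x) = -(x * t) := by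
      simp; field_simp; ring
    have e2 : t / (4 * π) = (4 * π)⁻¹ * t := by ring
    rw [e1, e2, smul_eq_mul]; push_cast; ring
  simp_rw [h3]
  rw [integral_const_mul, h2, inv_inv, abs_of_pos (by positivity), real_smul]
  push_cast; ring

lemma half_line (x : ℝ) : ∫ t in Set.Ioi (0:ℝ), completedRiemannZeta (1 / 2 + t * I) * Real.cos (x * t) =
    π * gg (-2 * x) := by
  set f : ℝ → ℂ := fun t => completedRiemannZeta (1 / 2 + t * I) * cexp (-(x * t) * I) with hf
  have hfi : Integrable f := by
    refine line_int.mul_bdd (c := 1) ?_ ?_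
    · exact (by fun_prop : Continuous fun t : ℝ => cexp (-(x * t) * I)).aestronglyMeasurable
    · refine Filter.Eventually.of_forall fun t => ?_
      rw [Complex.norm_exp]; simp
  have h1 := line_inv x
  rw [← integral_add_compl (measurableSet_Iic (a := (0:ℝ))) hfi, Set.compl_Iic] at h1
  have h2 : ∫ t in Set.Iic (0:ℝ), f t = ∫ t in Set.Ioi (0:ℝ), f (-t) := by
    have := integral_comp_neg_Ioi (0:ℝ) f
    simp [this]
  rw [h2, ← integral_add hfi.comp_neg.integrableOn hfi.integrableOn] at h1
  have h3 : ∀ t : ℝ, f (-t) + f t = 2 * (completedRiemannZeta (1 / 2 + t * I) * Real.cos (x * t)) := by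
    intro t
    simp only [hf]
    rw [line_even, ofReal_cos, Complex.cos]
    push_cast
    rw [show -((x:ℂ) * -t) * I = x * t * I by ring]
    ring
  simp_rw [h3] at h1
  rw [integral_const_mul] at h1
  linear_combination h1 / 2

theorem stmt13 (x : ℝ) :
    ∫ t in Set.Ioi (0 : ℝ), xi (1 / 2 + t * I) / ((t : ℂ) ^ 2 + 1 / 4) * Real.cos (x * t)
      = π / 2 * ((Real.exp (x / 2) - 2 * Real.exp (-x / 2) * jpsi (Real.exp (-2 * x)) : ℝ) : ℂ) := by
  have h : ∀ t : ℝ, xi (1 / 2 + t * I) / ((t : ℂ) ^ 2 + 1 / 4) * Real.cos (x * t) =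
      (-1 / 2 : ℂ) * (completedRiemannZeta (1 / 2 + t * I) * Real.cos (x * t)) := by
    intro t; rw [xi_eq]; ring
  simp_rw [h]
  rw [integral_const_mul, half_line]
  push_cast
  rw [jpsi_eq _ (Real.exp_pos _), gg, GG]
  push_cast
  have e1 : cexp (-2 * (x:ℂ) / 4) = cexp (-(x:ℂ) / 2) := by congr 1; ring
  have e2 : cexp (-(-2 * (x:ℂ)) / 2) = cexp ((x:ℂ) / 2) * cexp ((x:ℂ) / 2) := by
    rw [← Complex.exp_add]; congr 1; ring
  have e3 : cexp (-(x:ℂ) / 2) * cexp ((x:ℂ) / 2) = 1 := by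
    rw [← Complex.exp_add, ← Complex.exp_zero]; congr 1; ring
  rw [e1, e2]
  linear_combination (π / 2 * cexp ((x:ℂ) / 2)) * e3
end

section
/- With notation as in Hecke's formula, the function Ω_K(s,χ) = (2π)^(-s) Γ(s) |D|^(s/2) L_K(s,χ) satisfies the functional equation Ω_K(s,χ) = Ω_K(1−s,χ). -/
open MeasureTheory Real Complex

open NumberField

variable (K : Type) [Field K] [NumberField K]

/-- The Hecke L-series of a class group character, as a sum over nonzero integral ideals. -/
noncomputable def heckeL (χ : ClassGroup (𝓞 K) →* ℂ) (s : ℂ) : ℂ :=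
  ∑' I : (nonZeroDivisors (Ideal (𝓞 K))),
    χ (ClassGroup.mk0 I) * (Ideal.absNorm (I : Ideal (𝓞 K)) : ℂ) ^ (-s)

/-- The constant `D̄` of Hecke's formula. -/
noncomputable def Dbar (D : ℤ) : ℤ := if D = -3 then 6 else if D = -4 then -4 else 2


noncomputable def bqf (a b c : ℝ) (p : ℤ × ℤ) : ℝ := a * p.1 ^ 2 + 2 * b * p.1 * p.2 + c * p.2 ^ 2

lemma bqf_lower {a b c : ℝ} (ha : 0 < a) (h : a * c - b ^ 2 = 1) (p : ℤ × ℤ) :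
    (1 / (a + c)) * ((p.1 : ℝ) ^ 2 + (p.2 : ℝ) ^ 2) ≤ bqf a b c p ∧ 0 < 1 / (a + c) := by
  have hc : 0 < c := by
    by_contra hc
    nlinarith [sq_nonneg b]
  have hac : 0 < a + c := by positivity
  refine ⟨?_, by positivity⟩
  rw [div_mul_eq_mul_div, div_le_iff₀ hac, ← h, bqf]
  nlinarith [sq_nonneg (a * p.1 + b * p.2), sq_nonneg (b * p.1 + c * p.2)]

lemma summable_exp_sq {c : ℝ} (hc : 0 < c) : Summable fun n : ℤ => rexp (-c * (n : ℝ) ^ 2) := by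
  have := summable_pow_mul_jacobiTheta₂_term_bound 0 (div_pos hc pi_pos) 0
  refine this.congr fun n => ?_
  simp only [pow_zero, one_mul, mul_zero, zero_mul, sub_zero]
  congr 1
  field_simp

lemma summable_exp_sq2 {c d : ℝ} (hc : 0 < c) (hd : 0 < d) :
    Summable fun p : ℤ × ℤ => rexp (-(c * (p.1 : ℝ) ^ 2 + d * (p.2 : ℝ) ^ 2)) := by
  have := (summable_exp_sq hc).mul_of_nonneg (summable_exp_sq hd)
    (fun _ => (Real.exp_pos _).le) (fun _ => (Real.exp_pos _).le)
  refine this.congr fun p => ?_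
  rw [← Real.exp_add]; congr 1; ring

lemma summable_bqf {a b c : ℝ} (ha : 0 < a) (h : a * c - b ^ 2 = 1) {t : ℝ} (ht : 0 < t) :
    Summable fun p : ℤ × ℤ => rexp (-(π * bqf a b c p) * t) := by
  have h0 := (bqf_lower ha h 0).2
  have := summable_exp_sq2 (c := π * t * (1 / (a + c))) (d := π * t * (1 / (a + c)))
    (by positivity) (by positivity)
  refine Summable.of_nonneg_of_le (fun _ => (Real.exp_pos _).le) (fun p => ?_) this
  rw [Real.exp_le_exp]
  have := (bqf_lower ha h p).1
  have := mul_le_mul_of_nonneg_left this (by positivity : 0 ≤ π * t)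
  linarith

noncomputable def bth (a b c : ℝ) (t : ℝ) : ℂ :=
  ∑' p : ℤ × ℤ, (rexp (-(π * bqf a b c p) * t) : ℂ)

noncomputable def bG (a b : ℝ) (t : ℝ) (n k : ℤ) : ℂ :=
  cexp (-(π / a) * ((k : ℂ) ^ 2 / t + (n : ℂ) ^ 2 * t) + 2 * π * I * k * n * b / a)

lemma summable_bG {a : ℝ} (b : ℝ) (ha : 0 < a) {t : ℝ} (ht : 0 < t) :
    Summable fun p : ℤ × ℤ => bG a b t p.1 p.2 := by
  apply Summable.of_norm
  have := summable_exp_sq2 (c := π / a * t) (d := π / a / t) (by positivity) (by positivity)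
  refine this.congr fun p => ?_
  have : -((π : ℂ) / a) * ((p.2 : ℂ) ^ 2 / t + (p.1 : ℂ) ^ 2 * t) + 2 * π * I * p.2 * p.1 * b / a
    = ((-(π / a * t * (p.1 : ℝ) ^ 2 + π / a / t * (p.2 : ℝ) ^ 2) : ℝ) : ℂ)
      + ((2 * π * p.2 * p.1 * b / a : ℝ) : ℂ) * I := by
    push_cast
    field_simp
    ring
  rw [bG, this, Complex.norm_exp, Complex.add_re, Complex.ofReal_re, Complex.re_ofReal_mul, I_re,
    mul_zero, add_zero]

lemma bth_eq {a b c : ℝ} (ha : 0 < a) (h : a * c - b ^ 2 = 1) {t : ℝ} (ht : 0 < t) :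
    bth a b c t = 1 / ((√(t * a) : ℝ) : ℂ) * ∑' p : ℤ × ℤ, bG a b t p.1 p.2 := by
  have hs : Summable fun p : ℤ × ℤ => (rexp (-(π * bqf a b c p) * t) : ℂ) := by
    exact_mod_cast (summable_bqf ha h ht)
  have hta : 0 < t * a := by positivity
  have hsq : ((t : ℂ) * a) ^ (1 / 2 : ℂ) = ((√(t * a) : ℝ) : ℂ) := by
    rw [Real.sqrt_eq_rpow, Complex.ofReal_cpow hta.le]; push_cast; rfl
  have hs' : Summable fun p : ℤ × ℤ => (rexp (-(π * bqf a b c p.swap) * t) : ℂ) :=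
    (Equiv.prodComm ℤ ℤ).summable_iff.mpr hs
  have e1 : bth a b c t = ∑' p : ℤ × ℤ, (rexp (-(π * bqf a b c p.swap) * t) : ℂ) :=
    ((Equiv.prodComm ℤ ℤ).tsum_eq (fun p => (rexp (-(π * bqf a b c p) * t) : ℂ))).symm
  rw [e1, hs'.tsum_prod, (summable_bG b ha ht).tsum_prod, ← tsum_mul_left]
  congr 1
  ext n
  have hP := Complex.tsum_exp_neg_quadratic (a := (t : ℂ) * a)
    (by rw [← Complex.ofReal_mul, Complex.ofReal_re]; exact hta) (-(t * b * n))
  rw [hsq] at hP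
  have htc : (t : ℂ) ≠ 0 := by exact_mod_cast ht.ne'
  have hac : (a : ℂ) ≠ 0 := by exact_mod_cast ha.ne'
  have hc : (a : ℂ) * c - b ^ 2 = 1 := by exact_mod_cast h
  have hc' : (c : ℂ) = (1 + b ^ 2) / a := by field_simp; linear_combination hc
  have e2 : ∀ m : ℤ, (rexp (-(π * bqf a b c (Prod.swap (n, m))) * t) : ℂ) =
      cexp (- π * t * c * n ^ 2) * cexp (-π * (t * a) * m ^ 2 + 2 * π * (-(t * b * n)) * m) := by
    intro m
    rw [← Complex.exp_add, Complex.ofReal_exp, bqf]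
    push_cast [Prod.swap]
    congr 1; ring
  simp_rw [e2]
  rw [tsum_mul_left, hP, mul_left_comm, ← tsum_mul_left]
  congr 2
  ext k
  rw [← Complex.exp_add, bG, hc']
  congr 1
  have hI := Complex.I_sq
  field_simp
  linear_combination (-t^2*b^2*n^2) * hI

lemma bth_feq {a b c : ℝ} (ha : 0 < a) (h : a * c - b ^ 2 = 1) {t : ℝ} (ht : 0 < t) :
    bth a b c (1 / t) = t * bth a b c t := by
  rw [bth_eq ha h ht, bth_eq ha h (t := 1 / t) (by positivity)]
  have : ∑' p : ℤ × ℤ, bG a b (1 / t) p.1 p.2 = ∑' p : ℤ × ℤ, bG a b t p.1 p.2 := by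
    rw [← (Equiv.prodComm ℤ ℤ).tsum_eq]
    congr 1
    ext p
    simp only [Equiv.prodComm_apply, Prod.fst_swap, Prod.snd_swap, bG]
    congr 1
    push_cast
    field_simp
    ring
  rw [this, ← mul_assoc]
  congr 1
  norm_cast
  rw [Real.sqrt_mul (by positivity), Real.sqrt_mul (by positivity), Real.sqrt_div (by positivity)]
  have h1 := Real.sqrt_ne_zero'.mpr ha
  have h2 := Real.sqrt_ne_zero'.mpr ht
  field_simp
  simp [Real.sq_sqrt ht.le]

lemma bqf_zero (a b c : ℝ) : bqf a b c 0 = 0 := by simp [bqf]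

lemma bqf_ge {a b c : ℝ} (ha : 0 < a) (h : a * c - b ^ 2 = 1) {p : ℤ × ℤ} (hp : p ≠ 0) :
    1 / (a + c) ≤ bqf a b c p := by
  obtain ⟨h1, h2⟩ := bqf_lower ha h p
  refine le_trans ?_ h1
  have : (1 : ℝ) ≤ (p.1 : ℝ) ^ 2 + (p.2 : ℝ) ^ 2 := by
    have : (1 : ℤ) ≤ p.1 ^ 2 + p.2 ^ 2 := by
      by_contra hcon
      have h3 : p.1 ^ 2 = 0 := by nlinarith [sq_nonneg p.1, sq_nonneg p.2]
      have h4 : p.2 ^ 2 = 0 := by nlinarith [sq_nonneg p.1, sq_nonneg p.2]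
      exact hp (Prod.ext (by simpa using h3) (by simpa using h4))
    exact_mod_cast this
  nlinarith

lemma bth_sub_hasSum {a b c : ℝ} (ha : 0 < a) (h : a * c - b ^ 2 = 1) {t : ℝ} (ht : 0 < t) :
    HasSum (fun p : ℤ × ℤ => (if p = 0 then 0 else 1 : ℂ) * rexp (-(π * bqf a b c p) * t))
      (bth a b c t - 1) := by
  have hs : Summable fun p : ℤ × ℤ => (rexp (-(π * bqf a b c p) * t) : ℂ) := by
    exact_mod_cast (summable_bqf ha h ht)
  have h1 := hs.hasSum.sub (hasSum_ite_eq (0 : ℤ × ℤ) (1 : ℂ))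
  refine h1.congr_fun ?_
  intro p
  by_cases hp : p = 0
  · simp [hp, bqf_zero]
  · simp [hp]

lemma bth_continuousOn {a b c : ℝ} (ha : 0 < a) (h : a * c - b ^ 2 = 1) :
    ContinuousOn (bth a b c) (Set.Ioi 0) := by
  intro x hx
  have hx : 0 < x := hx
  have : ContinuousOn (bth a b c) (Set.Ioi (x / 2)) := by
    unfold bth
    refine continuousOn_tsum (u := fun p => rexp (-(π * bqf a b c p) * (x / 2))) ?_
      (summable_bqf ha h (by positivity)) ?_
    · intro p; fun_prop
    · intro p t ht
      have ht : x / 2 < t := ht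
      rw [Complex.norm_real, Real.norm_eq_abs, Real.abs_exp, Real.exp_le_exp]
      have hq : 0 ≤ bqf a b c p := by
        obtain ⟨h1, h2⟩ := bqf_lower ha h p
        exact le_trans (by positivity) h1
      have := mul_le_mul_of_nonneg_left ht.le (mul_nonneg pi_pos.le hq)
      linarith
  exact (this.continuousAt (Ioi_mem_nhds (by linarith))).continuousWithinAt

lemma bth_top {a b c : ℝ} (ha : 0 < a) (h : a * c - b ^ 2 = 1) (r : ℝ) :
    (fun t => bth a b c t - 1) =O[Filter.atTop] (fun t : ℝ => t ^ r) := by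
  have h0 := (bqf_lower ha h 0).2
  set d := π * (1 / (a + c)) with hd
  have hdpos : 0 < d := by positivity
  refine Asymptotics.IsBigO.trans ?_ (isLittleO_exp_neg_mul_rpow_atTop hdpos r).isBigO
  set C := ∑' p : ℤ × ℤ, rexp (-(π * bqf a b c p) * 1)
  refine Asymptotics.IsBigO.of_bound (C * rexp d) ?_
  filter_upwards [Filter.eventually_ge_atTop 1] with t ht
  rw [← (bth_sub_hasSum ha h (by linarith : 0 < t)).tsum_eq, Real.norm_eq_abs, Real.abs_exp,
    mul_assoc, ← Real.exp_add]
  refine tsum_of_norm_bounded ((summable_bqf ha h one_pos).hasSum.mul_right _) ?_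
  intro p
  by_cases hp : p = 0
  · simp only [hp, if_true, zero_mul, norm_zero]; positivity
  · simp only [hp, if_false, one_mul]
    rw [Complex.norm_real, Real.norm_eq_abs, Real.abs_exp, ← Real.exp_add, Real.exp_le_exp]
    have := mul_le_mul_of_nonneg_left (bqf_ge ha h hp) pi_pos.le
    rw [← hd] at this
    nlinarith

lemma summable_bqf_rpow {a b c : ℝ} (ha : 0 < a) (h : a * c - b ^ 2 = 1) {σ : ℝ} (hσ : 1 < σ) :
    Summable fun p : ℤ × ℤ => ‖(if p = 0 then 0 else 1 : ℂ)‖ / (π * bqf a b c p) ^ σ := by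
  have h0 := (bqf_lower ha h 0).2
  set d := π * (1 / (a + c)) with hd
  have hdpos : 0 < d := by positivity
  have h1 := EisensteinSeries.summable_one_div_norm_rpow (k := 2 * σ) (by linarith)
  have h2 := ((finTwoArrowEquiv ℤ).symm.summable_iff.mpr h1).mul_left (d ^ (-σ))
  refine Summable.of_nonneg_of_le (fun p => ?_) (fun p => ?_) h2
  · obtain ⟨h1, h2⟩ := bqf_lower ha h p
    have : 0 ≤ bqf a b c p := le_trans (by positivity) h1
    positivity
  · by_cases hp : p = 0
    · simp only [hp, if_true, norm_zero, zero_div, Function.comp]; positivity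
    · simp only [hp, if_false, norm_one, Function.comp]
      set v := (finTwoArrowEquiv ℤ).symm p with hv
      have hv0 : v ≠ 0 := by
        intro h0
        apply hp
        have : p = finTwoArrowEquiv ℤ v := by simp [hv]
        rw [this, h0]; rfl
      have hvpos : 0 < ‖v‖ := norm_pos_iff.mpr hv0
      have hle : ‖v‖ ^ 2 ≤ (p.1 : ℝ) ^ 2 + (p.2 : ℝ) ^ 2 := by
        have : ‖v‖ ≤ √((p.1 : ℝ) ^ 2 + (p.2 : ℝ) ^ 2) := by
          rw [pi_norm_le_iff_of_nonneg (by positivity)]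
          intro i
          apply Real.le_sqrt_of_sq_le
          fin_cases i <;> simp [hv, finTwoArrowEquiv, Int.norm_eq_abs, sq_nonneg]
        calc ‖v‖ ^ 2 ≤ (√((p.1 : ℝ) ^ 2 + (p.2 : ℝ) ^ 2)) ^ 2 := by gcongr
          _ = _ := Real.sq_sqrt (by positivity)
      have hle2 : d * ‖v‖ ^ 2 ≤ π * bqf a b c p := by
        rw [hd, mul_assoc]
        refine mul_le_mul_of_nonneg_left ?_ pi_pos.le
        exact le_trans (mul_le_mul_of_nonneg_left hle h0.le) (bqf_lower ha h p).1
      rw [one_div, ← Real.rpow_neg (le_trans (by positivity) hle2), neg_mul_eq_mul_neg,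
        Real.rpow_mul hvpos.le, ← Real.mul_rpow hdpos.le (by positivity)]
      refine Real.rpow_le_rpow_of_nonpos (by positivity) ?_ (by linarith)
      simpa using hle2

theorem epstein {a b c : ℝ} (ha : 0 < a) (h : a * c - b ^ 2 = 1) :
    ∃ Λ : ℂ → ℂ, DifferentiableOn ℂ Λ {0, 1}ᶜ ∧ (∀ s, Λ (1 - s) = Λ s) ∧
      ∀ s : ℂ, 1 < s.re →
        HasSum (fun p : {p : ℤ × ℤ // p ≠ 0} =>
          Complex.Gamma s / ((π * bqf a b c p : ℝ) : ℂ) ^ s) (Λ s) := by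
  let P : WeakFEPair ℂ :=
    { f := bth a b c
      g := bth a b c
      k := 1
      ε := 1
      f₀ := 1
      g₀ := 1
      hf_int := (bth_continuousOn ha h).locallyIntegrableOn measurableSet_Ioi
      hg_int := (bth_continuousOn ha h).locallyIntegrableOn measurableSet_Ioi
      hk := one_pos
      hε := one_ne_zero
      h_feq := fun x hx => by
        rw [bth_feq ha h hx]; simp
      hf_top := bth_top ha h
      hg_top := bth_top ha h }
  refine ⟨P.Λ, ?_, ?_, ?_⟩
  · intro s hs
    simp only [Set.mem_compl_iff, Set.mem_insert_iff, Set.mem_singleton_iff, not_or] at hs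
    exact (P.differentiableAt_Λ (Or.inl hs.1)
      (Or.inl (by simpa [P] using hs.2))).differentiableWithinAt
  · intro s
    have h1 := P.functional_equation s
    have h2 : P.symm.Λ = P.Λ := by
      have : P.symm = P := by simp [P, WeakFEPair.symm]
      rw [this]
    rw [h2] at h1
    simpa [P] using h1
  · intro s hs
    have hM := (P.hasMellin (s := s) hs).2
    have h1 := hasSum_mellin (a := fun p : ℤ × ℤ => (if p = 0 then 0 else 1 : ℂ))
      (p := fun p => π * bqf a b c p) (F := fun t => bth a b c t - 1) (s := s) (fun p => ?_)
      (by linarith) (fun t ht => bth_sub_hasSum ha h ht) (summable_bqf_rpow ha h hs)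
    · have hM' : mellin (fun t => bth a b c t - 1) s = P.Λ s := hM
      rw [hM'] at h1
      have h2 := (hasSum_subtype_iff_of_support_subset (s := {p : ℤ × ℤ | p ≠ 0})
        (f := fun p : ℤ × ℤ => Complex.Gamma s * (if p = 0 then 0 else 1 : ℂ) /
          ((π * bqf a b c p : ℝ) : ℂ) ^ s) ?_).mpr h1
      · refine h2.congr_fun fun p => ?_
        have := p.2
        simp only [Set.mem_ofPred_eq] at this
        simp [this]
      · intro p hp hp0
        simp [hp0] at hp
    · by_cases hp : p = 0
      · left; simp [hp]
      · right
        exact mul_pos pi_pos (lt_of_lt_of_le (bqf_lower ha h 0).2 (bqf_ge ha h hp))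

lemma quad_form (hdeg : Module.finrank ℚ K = 2) (x y : 𝓞 K) :
    ∃ B : ℤ, (∀ m n : ℤ, Algebra.norm ℤ ((m : 𝓞 K) * x + n * y) =
      Algebra.norm ℤ x * m ^ 2 + B * m * n + Algebra.norm ℤ y * n ^ 2) ∧
      B ^ 2 - 4 * Algebra.norm ℤ x * Algebra.norm ℤ y = Algebra.discr ℤ ![x, y] := by
  classical
  have hcard : Fintype.card (Fin 2) = Fintype.card (K →ₐ[ℚ] ℂ) := by
    rw [AlgHom.card, hdeg, Fintype.card_fin]
  let σ : Fin 2 ≃ (K →ₐ[ℚ] ℂ) := Fintype.equivOfCardEq hcard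
  have hN : ∀ z : 𝓞 K, ((Algebra.norm ℤ z : ℤ) : ℂ) = σ 0 (z : K) * σ 1 (z : K) := by
    intro z
    have h1 := Algebra.norm_eq_prod_embeddings ℚ ℂ (z : K)
    rw [← Algebra.coe_norm_int, ← σ.prod_comp, Fin.prod_univ_two] at h1
    simpa using h1
  have hT : ∀ z : 𝓞 K, ((Algebra.trace ℤ (𝓞 K) z : ℤ) : ℂ) = σ 0 (z : K) + σ 1 (z : K) := by
    intro z
    have h1 := trace_eq_sum_embeddings (K := ℚ) ℂ (x := (z : K))
    rw [← Algebra.coe_trace_int, ← σ.sum_comp, Fin.sum_univ_two] at h1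
    simpa using h1
  refine ⟨Algebra.norm ℤ (x + y) - Algebra.norm ℤ x - Algebra.norm ℤ y, fun m n => ?_, ?_⟩
  · have : ((Algebra.norm ℤ ((m : 𝓞 K) * x + n * y) : ℤ) : ℂ) = ((
      Algebra.norm ℤ x * m ^ 2 + (Algebra.norm ℤ (x + y) - Algebra.norm ℤ x - Algebra.norm ℤ y) * m * n + Algebra.norm ℤ y * n ^ 2 : ℤ) : ℂ) := by
      push_cast
      simp only [hN]
      push_cast
      simp only [map_add, map_mul, map_intCast]
      ring
    exact_mod_cast this
  · have : (((Algebra.norm ℤ (x + y) - Algebra.norm ℤ x - Algebra.norm ℤ y) ^ 2 - 4 * Algebra.norm ℤ x * Algebra.norm ℤ y : ℤ) : ℂ) = ((Algebra.discr ℤ ![x, y] : ℤ) : ℂ) := by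
      rw [Algebra.discr_def, Matrix.det_fin_two]
      simp only [Algebra.traceMatrix_apply, Algebra.traceForm_apply, Matrix.cons_val_zero, Matrix.cons_val_one]
      push_cast
      simp only [hN, hT]
      push_cast
      simp only [map_add, map_mul]
      ring
    exact_mod_cast this

lemma ideal_form (hdeg : Module.finrank ℚ K = 2) (hD : discr K < 0)
    (J : Ideal (𝓞 K)) (hJ : J ≠ ⊥) :
    ∃ (x y : 𝓞 K) (B : ℤ), (∀ z : 𝓞 K, z ∈ J ↔ ∃ m n : ℤ, z = m * x + n * y) ∧
      (∀ m n : ℤ, (m : 𝓞 K) * x + n * y = 0 → m = 0 ∧ n = 0) ∧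
      (∀ m n : ℤ, Algebra.norm ℤ ((m : 𝓞 K) * x + n * y) =
        Algebra.norm ℤ x * m ^ 2 + B * m * n + Algebra.norm ℤ y * n ^ 2) ∧
      B ^ 2 - 4 * Algebra.norm ℤ x * Algebra.norm ℤ y = (Ideal.absNorm J : ℤ) ^ 2 * discr K ∧
      0 < Algebra.norm ℤ x := by
  classical
  have hr : Module.finrank ℤ (𝓞 K) = 2 := by rw [RingOfIntegers.rank, hdeg]
  let b : Module.Basis (Fin 2) ℤ (𝓞 K) := Module.finBasisOfFinrankEq ℤ (𝓞 K) hr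
  let bI : Module.Basis (Fin 2) ℤ J := Ideal.selfBasis b J hJ
  have hdet := Ideal.natAbs_det_basis_change b J bI
  have hNJ : (Ideal.absNorm J : ℤ) ≠ 0 := by
    simpa [Ideal.absNorm_eq_zero_iff] using hJ
  have hdiscr : Algebra.discr ℤ ![((bI 0 : J) : 𝓞 K), ((bI 1 : J) : 𝓞 K)] =
      (Ideal.absNorm J : ℤ) ^ 2 * discr K := by
    have e : ![((bI 0 : J) : 𝓞 K), ((bI 1 : J) : 𝓞 K)] = ((↑) ∘ bI : Fin 2 → 𝓞 K) := by
      ext i; fin_cases i <;> rfl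
    rw [e, ← NumberField.discr_eq_discr K b, ← hdet, Int.natAbs_sq, Module.Basis.det_apply,
      ← Algebra.discr_of_matrix_vecMul, Module.Basis.toMatrix_map_vecMul]
  obtain ⟨B, h1, h2⟩ := quad_form K hdeg (bI 0 : 𝓞 K) (bI 1 : 𝓞 K)
  have hmem : ∀ z : 𝓞 K, z ∈ J ↔ ∃ m n : ℤ, z = m * (bI 0 : 𝓞 K) + n * (bI 1 : 𝓞 K) := by
    intro z
    constructor
    · intro hz
      refine ⟨bI.repr ⟨z, hz⟩ 0, bI.repr ⟨z, hz⟩ 1, ?_⟩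
      have := bI.sum_repr ⟨z, hz⟩
      rw [Fin.sum_univ_two] at this
      have := congrArg (Subtype.val) this
      simpa using this.symm
    · rintro ⟨m, n, rfl⟩
      exact J.add_mem (J.mul_mem_left _ (bI 0).2) (J.mul_mem_left _ (bI 1).2)
  refine ⟨bI 0, bI 1, B, hmem, ?_, h1, h2.trans hdiscr, ?_⟩
  · intro m n h
    have hl := Fintype.linearIndependent_iff.mp bI.linearIndependent ![m, n] (by
      rw [Fin.sum_univ_two]
      apply Subtype.ext
      simpa using h)
    exact ⟨hl 0, hl 1⟩
  · rw [hdiscr] at h2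
    obtain ⟨m, n, hmn⟩ := (hmem ((Ideal.absNorm J : ℕ) : 𝓞 K)).mp (Ideal.absNorm_mem J)
    have h3 := h1 m n
    rw [← hmn] at h3
    have h4 : Algebra.norm ℤ ((Ideal.absNorm J : ℕ) : 𝓞 K) = (Ideal.absNorm J : ℤ) ^ 2 := by
      have := Algebra.norm_algebraMap_of_basis b (Ideal.absNorm J : ℤ)
      simpa using this
    rw [h4] at h3
    set N := (Ideal.absNorm J : ℤ)
    set X := Algebra.norm ℤ (bI 0 : 𝓞 K)
    set Y := Algebra.norm ℤ (bI 1 : 𝓞 K)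
    have hN2 : 0 < N ^ 2 := by positivity
    have hneg : N ^ 2 * discr K < 0 := mul_neg_of_pos_of_neg hN2 hD
    have h5 : 0 ≤ X * N ^ 2 := by
      have : 4 * (X * N ^ 2) = (2 * X * m + B * n) ^ 2 - (N ^ 2 * discr K) * n ^ 2 := by
        rw [← h2]
        linear_combination (4 * X) * h3
      nlinarith [sq_nonneg (2 * X * m + B * n), sq_nonneg n]
    have h6 : X ≠ 0 := by
      intro h0
      rw [h0] at h2
      nlinarith [sq_nonneg B]
    have h7 : 0 ≤ X := nonneg_of_mul_nonneg_left h5 hN2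
    omega

set_option maxHeartbeats 1000000 in
lemma class_equiv (hdeg : Module.finrank ℚ K = 2) (hD : discr K < 0) (C : ClassGroup (𝓞 K)) :
    ∃ (a b c : ℝ), 0 < a ∧ a * c - b ^ 2 = 1 ∧
    ∃ F : (𝓞 K)ˣ × {I : nonZeroDivisors (Ideal (𝓞 K)) // ClassGroup.mk0 I = C} →
      {p : ℤ × ℤ // p ≠ 0}, Function.Bijective F ∧
      ∀ u, bqf a b c (F u) = 2 / √((|discr K| : ℤ) : ℝ) * (Ideal.absNorm (u.2.1 : Ideal (𝓞 K)) : ℝ) := by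
  obtain ⟨J, hJC⟩ := ClassGroup.mk0_surjective (C⁻¹)
  have hJ0 : (J : Ideal (𝓞 K)) ≠ ⊥ := nonZeroDivisors.coe_ne_zero J
  obtain ⟨x, y, B, hmem, hlin, hnorm, hdisc, hpos⟩ := ideal_form K hdeg hD J hJ0
  have hN : (0 : ℝ) < (Ideal.absNorm (J : Ideal (𝓞 K)) : ℝ) := by
    have : Ideal.absNorm (J : Ideal (𝓞 K)) ≠ 0 := by simpa [Ideal.absNorm_eq_zero_iff] using hJ0
    positivity
  have hD' : (0 : ℝ) < ((|discr K| : ℤ) : ℝ) := by exact_mod_cast abs_pos.mpr hD.ne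
  set δ := √((|discr K| : ℤ) : ℝ) with hδ
  have hδpos : 0 < δ := Real.sqrt_pos.mpr hD'
  have hδ2 : δ ^ 2 = - (discr K : ℝ) := by
    rw [hδ, Real.sq_sqrt hD'.le, abs_of_neg hD]; push_cast; rfl
  set N : ℝ := (Ideal.absNorm (J : Ideal (𝓞 K)) : ℝ) with hNdef
  have hX : (0 : ℝ) < (Algebra.norm ℤ x : ℝ) := by exact_mod_cast hpos
  have hdiscR : (B : ℝ) ^ 2 - 4 * (Algebra.norm ℤ x : ℝ) * (Algebra.norm ℤ y : ℝ)
      = N ^ 2 * (discr K : ℝ) := by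
    rw [hNdef]; exact_mod_cast hdisc
  have hA : 0 < 2 / (N * δ) * (Algebra.norm ℤ x : ℝ) := by positivity
  have hABC : (2 / (N * δ) * (Algebra.norm ℤ x : ℝ)) * (2 / (N * δ) * (Algebra.norm ℤ y : ℝ)) -
      (1 / (N * δ) * (B : ℝ)) ^ 2 = 1 := by
    field_simp
    rw [hδ2]
    linear_combination -hdiscR
  refine ⟨_, _, _, hA, hABC, ?_⟩
  have hgen : ∀ I : {I : nonZeroDivisors (Ideal (𝓞 K)) // ClassGroup.mk0 I = C},
      ∃ g : 𝓞 K, Ideal.span {g} = (I.1 : Ideal (𝓞 K)) * (J : Ideal (𝓞 K)) := by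
    intro I
    have h1 : ClassGroup.mk0 (I.1 * J) = 1 := by rw [map_mul, I.2, hJC, mul_inv_cancel]
    have h2 := (ClassGroup.mk0_eq_one_iff (I := ((I.1 * J : nonZeroDivisors (Ideal (𝓞 K))) : Ideal (𝓞 K)))
      (I.1 * J).2).mp h1
    obtain ⟨g, hg⟩ := h2
    exact ⟨g, by rw [Ideal.span, ← hg]; rfl⟩
  choose g hg using hgen
  have hg0 : ∀ I, g I ≠ 0 := by
    intro I h0
    have := hg I
    rw [h0, Ideal.span_singleton_zero] at this
    have h3 : ((I.1 * J : nonZeroDivisors (Ideal (𝓞 K))) : Ideal (𝓞 K)) ≠ ⊥ :=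
      nonZeroDivisors.coe_ne_zero _
    exact h3 (by rw [Submonoid.coe_mul]; exact this.symm)
  have hgJ : ∀ (u : (𝓞 K)ˣ) I, (u : 𝓞 K) * g I ∈ (J : Ideal (𝓞 K)) := by
    intro u I
    apply Ideal.mul_mem_left
    have : g I ∈ Ideal.span {g I} := Ideal.mem_span_singleton_self _
    rw [hg] at this
    have hle : (I.1 : Ideal (𝓞 K)) * (J : Ideal (𝓞 K)) ≤ (J : Ideal (𝓞 K)) := Ideal.mul_le_right
    exact hle this
  choose m n hmn using fun (u : (𝓞 K)ˣ × {I : nonZeroDivisors (Ideal (𝓞 K)) // ClassGroup.mk0 I = C}) =>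
    (hmem _).mp (hgJ u.1 u.2)
  refine ⟨fun u => ⟨(m u, n u), ?_⟩, ⟨?_, ?_⟩, ?_⟩
  · intro h0
    have h1 : m u = 0 := congrArg Prod.fst h0
    have h2 : n u = 0 := congrArg Prod.snd h0
    have := hmn u
    rw [h1, h2] at this
    simp [hg0] at this
  · rintro ⟨u, I⟩ ⟨v, I'⟩ h
    have h' := Subtype.ext_iff.mp h
    have h1 : m (u, I) = m (v, I') := congrArg Prod.fst h'
    have h2 : n (u, I) = n (v, I') := congrArg Prod.snd h'
    have h3 : (u : 𝓞 K) * g I = v * g I' := by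
      rw [hmn (u, I), hmn (v, I'), h1, h2]
    have h4 : I = I' := by
      have : Ideal.span {g I} = Ideal.span {g I'} := by
        rw [Ideal.span_singleton_eq_span_singleton]
        refine ⟨u * v⁻¹, ?_⟩
        rw [Units.val_mul, ← mul_assoc, mul_comm (g I), h3, mul_comm (v : 𝓞 K), mul_assoc,
          Units.mul_inv, mul_one]
      rw [hg, hg] at this
      exact Subtype.ext (Subtype.ext (mul_right_cancel₀ hJ0 this))
    subst h4
    have h5 := mul_right_cancel₀ (hg0 I) h3
    rw [Units.ext h5]
  · rintro ⟨⟨p, q⟩, hp⟩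
    have hz : (p : 𝓞 K) * x + q * y ∈ (J : Ideal (𝓞 K)) := (hmem _).mpr ⟨p, q, rfl⟩
    have hz0 : (p : 𝓞 K) * x + q * y ≠ 0 := by
      intro h
      obtain ⟨h1, h2⟩ := hlin _ _ h
      exact hp (by rw [h1, h2]; rfl)
    obtain ⟨I, hI⟩ := Ideal.dvd_span_singleton.mpr hz
    have hI0 : I ≠ 0 := by
      rintro rfl
      rw [mul_zero, Ideal.zero_eq_bot, Ideal.span_singleton_eq_bot] at hI
      exact hz0 hI
    let I' : nonZeroDivisors (Ideal (𝓞 K)) := ⟨I, mem_nonZeroDivisors_of_ne_zero hI0⟩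
    have hI' : ClassGroup.mk0 I' = C := by
      have h1 : ClassGroup.mk0 (J * I') = 1 := by
        refine (ClassGroup.mk0_eq_one_iff (J * I').2).mpr ?_
        change Submodule.IsPrincipal ((J : Ideal (𝓞 K)) * I)
        rw [← hI]
        exact ⟨_, rfl⟩
      rw [map_mul, hJC, inv_mul_eq_one] at h1
      exact h1.symm
    have h2 : Ideal.span {g ⟨I', hI'⟩} = Ideal.span {(p : 𝓞 K) * x + q * y} := by
      rw [hg, hI, mul_comm]
    rw [Ideal.span_singleton_eq_span_singleton] at h2
    obtain ⟨u, hu⟩ := h2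
    refine ⟨(u, ⟨I', hI'⟩), ?_⟩
    have h3 := hmn (u, ⟨I', hI'⟩)
    have h4 : ((m (u, ⟨I', hI'⟩) - p : ℤ) : 𝓞 K) * x + ((n (u, ⟨I', hI'⟩) - q : ℤ) : 𝓞 K) * y = 0 := by
      push_cast
      linear_combination hu - h3
    obtain ⟨h5, h6⟩ := hlin _ _ h4
    apply Subtype.ext
    exact Prod.ext (sub_eq_zero.mp h5) (sub_eq_zero.mp h6)
  · intro u
    have h1 := hnorm (m u) (n u)
    have hb : bqf (2 / (N * δ) * (Algebra.norm ℤ x : ℝ)) (1 / (N * δ) * (B : ℝ))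
        (2 / (N * δ) * (Algebra.norm ℤ y : ℝ)) (m u, n u) =
        2 / (N * δ) * (Algebra.norm ℤ ((m u : 𝓞 K) * x + n u * y) : ℝ) := by
      rw [h1, bqf]; push_cast; ring
    have hnn : 0 ≤ bqf (2 / (N * δ) * (Algebra.norm ℤ x : ℝ)) (1 / (N * δ) * (B : ℝ))
        (2 / (N * δ) * (Algebra.norm ℤ y : ℝ)) (m u, n u) := by
      obtain ⟨h1, h2⟩ := bqf_lower hA hABC (m u, n u)
      exact le_trans (by positivity) h1
    have hnn2 : (0 : ℝ) ≤ (Algebra.norm ℤ ((m u : 𝓞 K) * x + n u * y) : ℝ) := by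
      rw [hb] at hnn
      exact nonneg_of_mul_nonneg_right hnn (by positivity)
    have hspan : Ideal.span {(m u : 𝓞 K) * x + n u * y} = (u.2.1 : Ideal (𝓞 K)) * (J : Ideal (𝓞 K)) := by
      rw [← hmn, ← hg, Ideal.span_singleton_eq_span_singleton]
      exact associated_unit_mul_left _ _ u.1.isUnit
    have habs := congrArg Ideal.absNorm hspan
    rw [Ideal.absNorm_span_singleton, map_mul] at habs
    have hnn3 : (0 : ℤ) ≤ (Algebra.norm ℤ ((m u : 𝓞 K) * x + n u * y)) := by exact_mod_cast hnn2
    have habs2 : (Algebra.norm ℤ ((m u : 𝓞 K) * x + n u * y) : ℤ) =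
        ((Ideal.absNorm (u.2.1 : Ideal (𝓞 K)) * Ideal.absNorm (J : Ideal (𝓞 K)) : ℕ) : ℤ) := by
      rw [← habs]; exact (Int.natAbs_of_nonneg hnn3).symm
    change bqf _ _ _ (m u, n u) = _
    rw [hb, habs2]
    push_cast
    rw [← hNdef]
    field_simp

lemma term_eq {d N : ℝ} (hd : 0 < d) (hN : 0 < N) (s : ℂ) :
    1 / ((π * (2 / √d * N) : ℝ) : ℂ) ^ s =
      (2 * π : ℂ) ^ (-s) * (d : ℂ) ^ (s / 2) * (N : ℂ) ^ (-s) := by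
  have key : ∀ {x : ℝ}, 0 < x → ∀ w : ℂ, (x : ℂ) ^ w = cexp (Real.log x * w) := by
    intro x hx w
    rw [Complex.cpow_def_of_ne_zero (by exact_mod_cast hx.ne'), Complex.ofReal_log hx.le]
  have h2 : (2 * π : ℂ) = ((2 * π : ℝ) : ℂ) := by push_cast; rfl
  have hsd : 0 < √d := Real.sqrt_pos.mpr hd
  rw [h2, key (by positivity), key (by positivity), key hd, key hN, one_div, ← Complex.exp_neg,
    ← Complex.exp_add, ← Complex.exp_add]
  congr 1
  have : Real.log (π * (2 / √d * N)) = Real.log (2 * π) - Real.log d / 2 + Real.log N := by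
    rw [show π * (2 / √d * N) = (2 * π) / √d * N by ring, Real.log_mul (by positivity) hN.ne',
      Real.log_div (by positivity) hsd.ne', Real.log_sqrt hd.le]
  rw [this]
  push_cast
  ring

lemma class_series (hdeg : Module.finrank ℚ K = 2) (hD : discr K < 0) (C : ClassGroup (𝓞 K)) :
    ∃ Λ : ℂ → ℂ, DifferentiableOn ℂ Λ {0, 1}ᶜ ∧ (∀ s, Λ (1 - s) = Λ s) ∧
      ∀ s : ℂ, 1 < s.re →
        HasSum (fun I : {I : nonZeroDivisors (Ideal (𝓞 K)) // ClassGroup.mk0 I = C} =>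
          (2 * π : ℂ) ^ (-s) * Complex.Gamma s * ((|discr K| : ℤ) : ℂ) ^ (s / 2) *
          (Ideal.absNorm (I.1 : Ideal (𝓞 K)) : ℂ) ^ (-s)) (Λ s) := by
  obtain ⟨a, b, c, ha, h, F, hF, hFn⟩ := class_equiv K hdeg hD C
  obtain ⟨Λ, hd, hfe, hsum⟩ := epstein ha h
  have hD' : (0 : ℝ) < ((|discr K| : ℤ) : ℝ) := by exact_mod_cast abs_pos.mpr hD.ne
  have hNpos : ∀ I : nonZeroDivisors (Ideal (𝓞 K)),
      (0 : ℝ) < (Ideal.absNorm (I : Ideal (𝓞 K)) : ℝ) := by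
    intro I
    have : Ideal.absNorm (I : Ideal (𝓞 K)) ≠ 0 := by
      rw [Ne, Ideal.absNorm_eq_zero_iff]; exact nonZeroDivisors.coe_ne_zero I
    positivity
  let T : ℂ → {I : nonZeroDivisors (Ideal (𝓞 K)) // ClassGroup.mk0 I = C} → ℂ := fun s I =>
    (2 * π : ℂ) ^ (-s) * Complex.Gamma s * ((|discr K| : ℤ) : ℂ) ^ (s / 2) *
          (Ideal.absNorm (I.1 : Ideal (𝓞 K)) : ℂ) ^ (-s)
  have hsum2 : ∀ s : ℂ, 1 < s.re → HasSum (fun q :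
      {I : nonZeroDivisors (Ideal (𝓞 K)) // ClassGroup.mk0 I = C} × (𝓞 K)ˣ => T s q.1) (Λ s) := by
    intro s hs
    have h1 := ((Equiv.prodComm _ _).trans (Equiv.ofBijective F hF)).hasSum_iff.mpr (hsum s hs)
    refine h1.congr_fun fun q => ?_
    have h2 := term_eq hD' (hNpos q.1.1) s
    simp only [Function.comp, Equiv.trans_apply, Equiv.prodComm_apply, Equiv.ofBijective_apply, hFn,
      Prod.swap]
    rw [div_eq_mul_one_div, h2]
    simp only [T]
    rw [Complex.ofReal_intCast, Complex.ofReal_natCast]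
    ring
  have hfin : Finite (𝓞 K)ˣ := by
    by_contra hinf
    rw [not_finite_iff_infinite] at hinf
    obtain ⟨I0, hI0⟩ := ClassGroup.mk0_surjective C
    have h1 := (hsum2 2 (by norm_num)).summable.prod_factor ⟨I0, hI0⟩
    have h1' : Summable fun _ : (𝓞 K)ˣ => T 2 ⟨I0, hI0⟩ := h1
    rw [summable_const_iff] at h1'
    clear h1
    have h1 := h1'
    have hN := hNpos I0
    simp only [T, mul_eq_zero, Complex.cpow_eq_zero_iff] at h1
    have h2 : Complex.Gamma 2 ≠ 0 := Complex.Gamma_ne_zero_of_re_pos (by norm_num)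
    have h3 : ((|discr K| : ℤ) : ℂ) ≠ 0 := by exact_mod_cast hD'.ne'
    have h4 : (Ideal.absNorm (I0 : Ideal (𝓞 K)) : ℂ) ≠ 0 := by exact_mod_cast hN.ne'
    have h5 := pi_ne_zero
    rcases h1 with ((h1 | h1) | h1) | h1
    · simp [h5] at h1
    · exact h2 h1
    · exact h3 h1.1
    · exact h4 h1.1
  have := Fintype.ofFinite (𝓞 K)ˣ
  have hw : (Fintype.card (𝓞 K)ˣ : ℂ) ≠ 0 := by exact_mod_cast Fintype.card_ne_zero
  refine ⟨fun s => (Fintype.card (𝓞 K)ˣ : ℂ)⁻¹ * Λ s, hd.const_mul _, fun s => by simp only [hfe], ?_⟩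
  intro s hs
  have h1 := (hsum2 s hs).prod_fiberwise (g := fun I => (Fintype.card (𝓞 K)ˣ : ℂ) * T s I)
    (fun I => by simpa using hasSum_fintype (fun _ : (𝓞 K)ˣ => T s I))
  refine (h1.mul_left (Fintype.card (𝓞 K)ˣ : ℂ)⁻¹).congr_fun fun I => ?_
  rw [inv_mul_cancel_left₀ hw]

theorem stmt17 (hdeg : Module.finrank ℚ K = 2) (hD : discr K < 0)
    (χ : ClassGroup (𝓞 K) →* ℂ) (Ω : ℂ → ℂ)
    (hΩser : ∀ s : ℂ, 1 < s.re →
      Ω s = (2 * π : ℂ) ^ (-s) * Complex.Gamma s * ((|discr K| : ℤ) : ℂ) ^ (s / 2) * heckeL K χ s)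
    (hΩmero : DifferentiableOn ℂ Ω {(0 : ℂ), 1}ᶜ)
    (s : ℂ) (hs0 : s ≠ 0) (hs1 : s ≠ 1) :
    Ω s = Ω (1 - s) := by
  classical
  choose Λ hd hfe hsum using class_series K hdeg hD
  let Ω₀ : ℂ → ℂ := fun s => ∑ C : ClassGroup (𝓞 K), χ C * Λ C s
  have hΩ₀d : DifferentiableOn ℂ Ω₀ {(0 : ℂ), 1}ᶜ := by
    apply DifferentiableOn.fun_sum
    intro C _
    exact (hd C).const_mul _
  have hΩ₀fe : ∀ s, Ω₀ (1 - s) = Ω₀ s := fun s => by simp only [Ω₀, hfe]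
  have hser : ∀ s : ℂ, 1 < s.re → Ω s = Ω₀ s := by
    intro s hs
    rw [hΩser s hs, heckeL, ← tsum_mul_left]
    apply HasSum.tsum_eq
    have h1 : ∀ C : ClassGroup (𝓞 K), HasSum
        ({I : nonZeroDivisors (Ideal (𝓞 K)) | ClassGroup.mk0 I = C}.indicator fun I =>
          χ C * ((2 * π : ℂ) ^ (-s) * Complex.Gamma s * ((|discr K| : ℤ) : ℂ) ^ (s / 2) *
          (Ideal.absNorm (I : Ideal (𝓞 K)) : ℂ) ^ (-s))) (χ C * Λ C s) := by
      intro C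
      rw [← hasSum_subtype_iff_indicator]
      exact (hsum C s hs).mul_left (χ C)
    refine (hasSum_sum (s := Finset.univ) fun C _ => h1 C).congr_fun fun I => ?_
    rw [Finset.sum_eq_single (ClassGroup.mk0 I)]
    · rw [Set.indicator_of_mem (by simp)]; ring
    · intro C _ hC
      exact Set.indicator_of_notMem (fun h => hC h.symm) _
    · intro h; exact absurd (Finset.mem_univ _) h
  have hopen : IsOpen ({(0 : ℂ), 1}ᶜ : Set ℂ) := (Set.toFinite _).isClosed.isOpen_compl
  have hconn : IsPreconnected ({(0 : ℂ), 1}ᶜ : Set ℂ) :=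
    ((Set.toFinite {(0 : ℂ), 1}).countable.isConnected_compl_of_one_lt_rank (by simp)).isPreconnected
  have heq : Set.EqOn Ω Ω₀ ({(0 : ℂ), 1}ᶜ : Set ℂ) := by
    refine (hΩmero.analyticOnNhd hopen).eqOn_of_preconnected_of_eventuallyEq
      (hΩ₀d.analyticOnNhd hopen) hconn (z₀ := 2) (by simp) ?_
    have : {s : ℂ | 1 < s.re} ∈ nhds (2 : ℂ) :=
      (isOpen_lt continuous_const Complex.continuous_re).mem_nhds (by simp)
    filter_upwards [this] with z hz using hser z hz
  have m1 : s ∈ ({(0 : ℂ), 1}ᶜ : Set ℂ) := by simp [hs0, hs1]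
  have m2 : 1 - s ∈ ({(0 : ℂ), 1}ᶜ : Set ℂ) := by
    simp only [Set.mem_compl_iff, Set.mem_insert_iff, Set.mem_singleton_iff, not_or]
    exact ⟨fun h => hs1 (sub_eq_zero.mp h).symm, fun h => hs0 (by simpa using h)⟩
  rw [heq m1, heq m2, hΩ₀fe]
end
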